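/- For every integer n ≥ 3 there exist a Ważewski dendrite X of order n and a finitely generated subgroup G of Homeo(X) such that for every homeomorphism φ of X, every k ≥ 1 and all branch points p₁, …, p_k of X, there exists g ∈ G with g(p_i) = φ(p_i) for all i = 1, …, k. -/

import Mathlib

open Topology

/-- The set of connected components of a subset `S` of `X`. -/
def setComponents (X : Type*) [TopologicalSpace X] (S : Set X) : Set (Set X) :=
  {C | ∃ x ∈ S, C = connectedComponentIn S x}

/-- The order of a point `p` of `X`: the number of connected components of `X \ {p}`. -/
noncomputable def ptOrder (X : Type*) [TopologicalSpace X] (p : X) : ℕ :=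
  (setComponents X {p}ᶜ).ncard

/-- A dendrite: a nonempty, compact, connected, locally connected metrizable space
containing no subspace homeomorphic to the circle. -/
def IsDendrite (X : Type*) [TopologicalSpace X] : Prop :=
  Nonempty X ∧ CompactSpace X ∧ ConnectedSpace X ∧ LocallyConnectedSpace X ∧
    TopologicalSpace.MetrizableSpace X ∧
    ∀ S : Set X, IsEmpty (S ≃ₜ Circle)

/-- A Ważewski dendrite of order `n`: a dendrite all of whose points have order `1`, `2`
or `n`, and every arc (subspace homeomorphic to `[0,1]`) contains a point of order `n`. -/
def IsWazewskiDendrite (n : ℕ) (X : Type*) [TopologicalSpace X] : Prop :=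
  IsDendrite X ∧
  (∀ p : X, ptOrder X p = 1 ∨ ptOrder X p = 2 ∨ ptOrder X p = n) ∧
  ∀ A : Set X, Nonempty (A ≃ₜ unitInterval) → ∃ p ∈ A, ptOrder X p = n

/-- The group structure on self-homeomorphisms of `X`, with composition as product. -/
instance Homeomorph.instGroupSelf (X : Type*) [TopologicalSpace X] : Group (X ≃ₜ X) where
  mul f g := g.trans f
  one := Homeomorph.refl X
  inv := Homeomorph.symm
  mul_assoc _ _ _ := rfl
  one_mul _ := Homeomorph.ext fun _ => rfl
  mul_one _ := Homeomorph.ext fun _ => rfl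
  inv_mul_cancel := Homeomorph.self_trans_symm

/-- The compact-open topology on the group of self-homeomorphisms of `X` (for compact
metric `X`, this is the topology of uniform convergence). -/
instance Homeomorph.instTopSelf (X : Type*) [TopologicalSpace X] :
    TopologicalSpace (X ≃ₜ X) :=
  TopologicalSpace.induced (fun h : X ≃ₜ X => (h : C(X, X))) ContinuousMap.compactOpen


set_option linter.all false

open Set

/-- A compact topological meet-semilattice that is a densely ordered tree. -/
class TreeLike (X : Type*) [TopologicalSpace X] [SemilatticeInf X] [OrderBot X] : Prop where
  compact : CompactSpace X
  t2 : T2Space X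
  ocl : OrderClosedTopology X
  cinf : Continuous fun p : X × X => p.1 ⊓ p.2
  chain : ∀ x y z : X, y ≤ x → z ≤ x → y ≤ z ∨ z ≤ y
  dense : ∀ y z : X, y < z → ∃ b, y < b ∧ b < z

namespace TreeLike

attribute [instance] TreeLike.compact TreeLike.t2 TreeLike.ocl

section
variable {X : Type*} [TopologicalSpace X] [SemilatticeInf X] [OrderBot X] [TreeLike X]

theorem cont_inf_right (x : X) : Continuous fun z : X => z ⊓ x :=
  (TreeLike.cinf (X := X)).comp (continuous_id.prodMk continuous_const)

theorem not_le_iff_lt {x y z : X} (hy : y ≤ x) (hz : z ≤ x) : ¬ y ≤ z ↔ z < y := by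
  constructor
  · intro h
    rcases chain x y z hy hz with h1 | h1
    · exact absurd h1 h
    · exact lt_of_le_not_ge h1 h
  · intro h h2
    exact absurd h2 (not_le_of_gt h)

/-- The up-component at `p` containing `x`. -/
def up (p x : X) : Set X := {z | p < z ⊓ x}

/-- The down-component at `p`. -/
def dn (p : X) : Set X := {z | ¬ p ≤ z}

theorem isOpen_up {p x : X} (h : p ≤ x) : IsOpen (up p x) := by
  have : up p x = {z | z ⊓ x ≤ p}ᶜ := by
    ext z
    simp only [up, mem_setOf_eq, mem_compl_iff]
    exact (not_le_iff_lt (x := x) inf_le_right h).symm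
  rw [this]
  exact (isClosed_le (cont_inf_right x) continuous_const).isOpen_compl

theorem isOpen_dn (p : X) : IsOpen (dn p) :=
  (isClosed_Ici (a := p)).isOpen_compl

theorem isOpen_Ioi' (p : X) : IsOpen {z | p < z} := by
  rw [isOpen_iff_mem_nhds]
  intro z hz
  refine Filter.mem_of_superset ((isOpen_up (le_of_lt hz)).mem_nhds (?_ : z ∈ up p z)) ?_
  · simpa [up] using hz
  · intro u hu
    exact lt_of_lt_of_le hu inf_le_left

theorem inf_gt {p z u v : X} (h1 : p < z ⊓ u) (h2 : p < z ⊓ v) : p < u ⊓ v := by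
  rcases chain z (z ⊓ u) (z ⊓ v) inf_le_left inf_le_left with h | h
  · exact lt_of_lt_of_le h1 (le_inf inf_le_right (h.trans inf_le_right))
  · exact lt_of_lt_of_le h2 (le_inf (h.trans inf_le_right) inf_le_right)

theorem exists_Icc_subset {a k : X} (h : a < k) {V : Set X} (hV : V ∈ 𝓝 k) :
    ∃ y, a ≤ y ∧ y < k ∧ Icc y k ⊆ V := by
  let ι := {y : X // a ≤ y ∧ y < k}
  haveI : Nonempty ι := ⟨⟨a, le_rfl, h⟩⟩
  have hdir : Directed (· ⊇ ·) (fun i : ι => Icc i.1 k) := by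
    rintro ⟨i, hi⟩ ⟨j, hj⟩
    rcases chain k i j hi.2.le hj.2.le with h | h
    · exact ⟨⟨j, hj⟩, Icc_subset_Icc_left h, Icc_subset_Icc_left le_rfl⟩
    · exact ⟨⟨i, hi⟩, Icc_subset_Icc_left le_rfl, Icc_subset_Icc_left h⟩
  have hnh : ∀ z ∈ ⋂ i : ι, Icc i.1 k, V ∈ 𝓝 z := by
    intro z hz
    have hz' : ∀ y, a ≤ y → y < k → y ≤ z ∧ z ≤ k := fun y h1 h2 => by
      have := mem_iInter.1 hz ⟨y, h1, h2⟩
      exact this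
    have hzk := (hz' a le_rfl h).2
    have haz := (hz' a le_rfl h).1
    rcases hzk.lt_or_eq with h1 | h1
    · obtain ⟨b, hb1, hb2⟩ := dense _ _ h1
      exact absurd (hz' b (haz.trans hb1.le) hb2).1 (not_le_of_gt hb1)
    · rw [h1]; exact hV
  obtain ⟨i, hi⟩ := exists_subset_nhds_of_isCompact hdir
    (fun i => isClosed_Icc.isCompact) hnh
  exact ⟨i.1, i.2.1, i.2.2, hi⟩

theorem Icc_aux {a x : X} {U V : Set X} (hU : IsOpen U) (hV : IsOpen V) (hs : Icc a x ⊆ U ∪ V)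
    (ha : a ∈ U) (hv : (Icc a x ∩ V).Nonempty) : (Icc a x ∩ (U ∩ V)).Nonempty := by
  by_contra hcon
  have hne : ∀ z, z ∈ Icc a x → z ∈ U → z ∈ V → False := fun z h1 h2 h3 => hcon ⟨z, h1, h2, h3⟩
  obtain ⟨v, hvS, hvV⟩ := hv
  set K := Icc a x \ U with hK
  have hKc : IsCompact K := isClosed_Icc.isCompact.diff hU
  haveI : Nonempty K := ⟨⟨v, hvS, fun h => hne v hvS h hvV⟩⟩
  obtain ⟨k, hkK, hk⟩ : ∃ k ∈ K, ∀ y ∈ K, k ≤ y := by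
    by_contra hno
    have := hKc.elim_directed_family_closed (fun y : K => Iic (y : X)) (fun _ => isClosed_Iic) ?_ ?_
    · obtain ⟨y, hy⟩ := this
      have : (y : X) ∈ K ∩ Iic (y : X) := ⟨y.2, le_rfl⟩
      rw [hy] at this
      exact this
    · rw [eq_empty_iff_forall_notMem]
      rintro k ⟨hk1, hk2⟩
      exact hno ⟨k, hk1, fun y hy => mem_iInter.1 hk2 ⟨y, hy⟩⟩
    · rintro ⟨i, hi⟩ ⟨j, hj⟩
      rcases chain x i j hi.1.2 hj.1.2 with h | h
      · exact ⟨⟨i, hi⟩, Iic_subset_Iic.2 le_rfl, Iic_subset_Iic.2 h⟩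
      · exact ⟨⟨j, hj⟩, Iic_subset_Iic.2 h, Iic_subset_Iic.2 le_rfl⟩
  have hak : a < k := lt_of_le_of_ne hkK.1.1 (fun h => hkK.2 (h ▸ ha))
  have hkV : k ∈ V := (hs hkK.1).resolve_left hkK.2
  obtain ⟨y, hay, hyk, hyV⟩ := exists_Icc_subset hak (hV.mem_nhds hkV)
  have hyS : y ∈ Icc a x := ⟨hay, hyk.le.trans hkK.1.2⟩
  have : y ∈ K := ⟨hyS, fun h => hne y hyS h (hyV ⟨le_rfl, hyk.le⟩)⟩
  exact absurd (hk y this) (not_le_of_gt hyk)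

theorem isPreconnected_Icc' (a x : X) : IsPreconnected (Icc a x) := by
  intro U V hU hV hs hu hv
  have hax : a ≤ x := by
    obtain ⟨u, hu, _⟩ := hu
    exact hu.1.trans hu.2
  rcases hs ⟨le_rfl, hax⟩ with h | h
  · exact Icc_aux hU hV hs h hv
  · rw [inter_comm U V]
    exact Icc_aux hV hU (by rwa [union_comm]) h hu

/-- A set that is connected to a chain. -/
theorem isPreconnected_of_inf {S : Set X} {x : X} (hx : x ∈ S)
    (h : ∀ z ∈ S, ∀ u, z ⊓ x ≤ u → (u ≤ z ∨ u ≤ x) → u ∈ S) : IsPreconnected S := by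
  refine isPreconnected_of_forall x fun z hz => ⟨Icc (z ⊓ x) z ∪ Icc (z ⊓ x) x, ?_, ?_, ?_, ?_⟩
  · rintro u (hu | hu)
    · exact h z hz u hu.1 (Or.inl hu.2)
    · exact h z hz u hu.1 (Or.inr hu.2)
  · exact Or.inr ⟨inf_le_right, le_rfl⟩
  · exact Or.inl ⟨inf_le_left, le_rfl⟩
  · exact IsPreconnected.union (z ⊓ x) ⟨le_rfl, inf_le_left⟩ ⟨le_rfl, inf_le_right⟩
      (isPreconnected_Icc' _ _) (isPreconnected_Icc' _ _)

theorem isPreconnected_up {p x : X} (h : p < x) : IsPreconnected (up p x) := by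
  refine isPreconnected_of_inf (x := x) (by simpa [up] using h) fun z hz u hu _ => ?_
  exact lt_of_lt_of_le hz (le_inf hu inf_le_right)

theorem isPreconnected_dn {p : X} (h : p ≠ ⊥) : IsPreconnected (dn p) := by
  refine isPreconnected_of_inf (x := ⊥) (by simpa [dn] using h) fun z hz u _ hu hp => ?_
  rcases hu with hu | hu
  · exact hz (hp.trans hu)
  · exact h (le_bot_iff.1 (hp.trans hu))

theorem connectedSpace : ConnectedSpace X := by
  haveI : Nonempty X := ⟨⊥⟩
  haveI : PreconnectedSpace X :=
    ⟨isPreconnected_of_inf (x := ⊥) (mem_univ _) fun _ _ _ _ _ => mem_univ _⟩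
  exact ⟨inferInstance⟩

theorem comp_up {p x : X} (h : p < x) : connectedComponentIn {p}ᶜ x = up p x := by
  have hx : x ∈ up p x := by simpa [up] using h
  have hsub : up p x ⊆ {p}ᶜ := by
    rintro z hz rfl
    exact absurd (hz.trans_le inf_le_left) (lt_irrefl _)
  apply Subset.antisymm
  · refine isPreconnected_connectedComponentIn.subset_left_of_subset_union (isOpen_up h.le)
      (v := dn p ∪ ⋃ z ∈ {z | p < z ∧ ¬ p < z ⊓ x}, up p z) ?_ ?_ ?_ ?_
    · exact (isOpen_dn p).union (isOpen_biUnion fun z hz => isOpen_up hz.1.le)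
    · rw [Set.disjoint_left]
      rintro u hu (hu2 | hu2)
      · exact hu2 (hu.le.trans inf_le_left)
      · simp only [mem_iUnion] at hu2
        obtain ⟨z, hz, hz2⟩ := hu2
        exact hz.2 (inf_gt hz2 hu)
    · intro z hz
      have hzp : z ≠ p := by
        have := connectedComponentIn_subset _ _ hz
        exact this
      by_cases h1 : p ≤ z
      · by_cases h2 : p < z ⊓ x
        · exact Or.inl h2
        · have h3 := lt_of_le_of_ne h1 hzp.symm
          refine Or.inr (Or.inr (mem_biUnion (show z ∈ _ from ⟨h3, h2⟩) ?_))
          simpa [up] using h3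
      · exact Or.inr (Or.inl h1)
    · exact ⟨x, mem_connectedComponentIn (hsub hx), hx⟩
  · exact (isPreconnected_up h).subset_connectedComponentIn hx hsub

theorem comp_dn {p x : X} (h : ¬ p ≤ x) : connectedComponentIn {p}ᶜ x = dn p := by
  have hsub : dn p ⊆ {p}ᶜ := by
    rintro z hz rfl
    exact hz le_rfl
  apply Subset.antisymm
  · refine isPreconnected_connectedComponentIn.subset_left_of_subset_union (isOpen_dn p)
      (isOpen_Ioi' p) ?_ ?_ ?_
    · rw [Set.disjoint_left]
      intro u hu hu2
      exact hu (le_of_lt hu2)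
    · intro z hz
      have hzp : z ≠ p := by
        have := connectedComponentIn_subset _ _ hz
        exact this
      by_cases h1 : p ≤ z
      · exact Or.inr (lt_of_le_of_ne h1 hzp.symm)
      · exact Or.inl h1
    · exact ⟨x, mem_connectedComponentIn (hsub h), h⟩
  · refine (isPreconnected_dn ?_).subset_connectedComponentIn h hsub
    rintro rfl
    exact h bot_le

/-- Separation of two distinct points. -/
theorem separation {b x y : X} (h1 : ¬ b ≤ y) (h2 : b < x) {S : Set X} (hS : IsPreconnected S)
    (hx : x ∈ S) (hy : y ∈ S) : b ∈ S := by
  by_contra hb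
  have := hS.subset_left_of_subset_union (isOpen_dn b) (isOpen_Ioi' b) ?_ ?_ ⟨y, hy, h1⟩
  · exact (this hx) h2.le
  · rw [Set.disjoint_left]
    intro u hu hu2
    exact hu (le_of_lt hu2)
  · intro z hz
    by_cases h1 : b ≤ z
    · exact Or.inr (lt_of_le_of_ne h1 (fun h => hb (h ▸ hz)))
    · exact Or.inl h1

theorem exists_sep {x y : X} (h : x ≠ y) :
    (x ⊓ y < x) ∨ (x ⊓ y < y) := by
  by_contra hc
  push Not at hc
  have h1 : x ⊓ y = x := by
    by_contra h1
    exact hc.1 (lt_of_le_of_ne inf_le_left h1)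
  have h2 : x ⊓ y = y := by
    by_contra h1
    exact hc.2 (lt_of_le_of_ne inf_le_right h1)
  exact h (h1.symm.trans h2)

/-- basic neighbourhood -/
theorem locallyConnected : LocallyConnectedSpace X := by
  refine locallyConnectedSpace_of_connected_bases (ι := Set X) (fun _ s => s)
    (fun x s => s ∈ 𝓝 x ∧ IsPreconnected s) (fun x => ?_) (fun x s hs => hs.2)
  rw [Filter.hasBasis_iff]
  intro O
  refine ⟨fun hO => ?_, fun ⟨s, hs, hsO⟩ => Filter.mem_of_superset hs.1 hsO⟩
  obtain ⟨O', hO'O, hO'o, hxO'⟩ := mem_nhds_iff.1 hO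
  -- good neighbourhoods
  let good : Set X → Prop := fun s => IsOpen s ∧ x ∈ s ∧
    ∀ z ∈ s, ∀ u, z ⊓ x ≤ u → (u ≤ z ∨ u ≤ x) → u ∈ s
  have good_inter : ∀ s t, good s → good t → good (s ∩ t) := by
    rintro s t ⟨h1, h2, h3⟩ ⟨k1, k2, k3⟩
    exact ⟨h1.inter k1, ⟨h2, k2⟩, fun z hz u hu hu2 => ⟨h3 z hz.1 u hu hu2, k3 z hz.2 u hu hu2⟩⟩
  have good_univ : good univ := ⟨isOpen_univ, mem_univ _, fun _ _ _ _ _ => mem_univ _⟩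
  have key : ∀ z, z ≠ x → ∃ V ∈ 𝓝 z, ∃ s, good s ∧ Disjoint V s := by
    intro z hz
    by_cases h : x ≤ z
    · have hlt := lt_of_le_of_ne h hz.symm
      obtain ⟨b, hb1, hb2⟩ := dense _ _ hlt
      refine ⟨{u | b < u}, (isOpen_Ioi' b).mem_nhds hb2, dn b, ⟨isOpen_dn b,
        not_le_of_gt hb1, ?_⟩, ?_⟩
      · intro v hv u _ hu hbu
        rcases hu with hu | hu
        · exact hv (hbu.trans hu)
        · exact not_le_of_gt hb1 (hbu.trans hu)
      · rw [Set.disjoint_left]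
        intro u hu hu2
        exact hu2 (le_of_lt hu)
    · have hlt : z ⊓ x < x := lt_of_le_of_ne inf_le_right (fun h1 => h (inf_eq_right.1 h1))
      obtain ⟨b, hb1, hb2⟩ := dense _ _ hlt
      refine ⟨dn b, (isOpen_dn b).mem_nhds ?_, up b x, ⟨isOpen_up hb2.le, ?_, ?_⟩, ?_⟩
      · intro hbz
        exact not_le_of_gt hb1 (le_inf hbz hb2.le)
      · simpa [up] using hb2
      · intro v hv u hu _
        exact lt_of_lt_of_le hv (le_inf hu inf_le_right)
      · rw [Set.disjoint_left]
        intro u hu hu2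
        exact hu (hu2.le.trans inf_le_left)
  have hK : IsCompact O'ᶜ := hO'o.isClosed_compl.isCompact
  obtain ⟨s, hs, hd⟩ : ∃ s, good s ∧ Disjoint O'ᶜ s := by
    refine hK.induction_on (p := fun T => ∃ s, good s ∧ Disjoint T s) ?_ ?_ ?_ ?_
    · exact ⟨univ, good_univ, by simp⟩
    · rintro A C hAC ⟨s, hs, hd⟩
      exact ⟨s, hs, hd.mono_left hAC⟩
    · rintro A C ⟨s, hs, hd⟩ ⟨t, ht, hd2⟩
      refine ⟨s ∩ t, good_inter s t hs ht, ?_⟩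
      rw [Set.disjoint_left] at *
      rintro u (hu | hu) ⟨h1, h2⟩
      · exact hd hu h1
      · exact hd2 hu h2
    · intro z hz
      obtain ⟨V, hV, s, hs, hd⟩ := key z (fun h => hz (h ▸ hxO'))
      exact ⟨V, mem_nhdsWithin_of_mem_nhds hV, s, hs, hd⟩
  refine ⟨s, ⟨hs.1.mem_nhds hs.2.1, isPreconnected_of_inf hs.2.1 hs.2.2⟩, ?_⟩
  intro u hu
  by_contra hc
  exact Set.disjoint_left.1 hd (fun h => hc (hO'O h)) hu

theorem circle_compl (c : Circle) : IsPreconnected ({c}ᶜ : Set Circle) := by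
  have : ({c}ᶜ : Set Circle) = (fun t : ℝ => c * Circle.exp t) '' Ioo 0 (2 * Real.pi) := by
    ext z
    simp only [mem_compl_iff, mem_singleton_iff, mem_image, mem_Ioo]
    constructor
    · intro h
      obtain ⟨t, ht⟩ := Circle.exp_surjective (c⁻¹ * z)
      have hz : c * Circle.exp t = z := by rw [ht]; simp
      have hp : (0 : ℝ) < 2 * Real.pi := by positivity
      refine ⟨toIcoMod hp 0 t, ⟨?_, ?_⟩, ?_⟩
      · refine lt_of_le_of_ne (left_le_toIcoMod hp 0 t) fun h0 => h ?_
        have h2 : Circle.exp t = 1 := by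
          have h3 := toIcoMod_add_toIcoDiv_zsmul hp 0 t
          rw [← h0, zero_add] at h3
          rw [← h3]
          rw [Circle.exp_eq_one]
          exact ⟨toIcoDiv hp 0 t, by simp⟩
        rw [← hz, h2, mul_one]
      · simpa using toIcoMod_lt_right hp 0 t
      · rw [← hz]
        congr 1
        rw [Circle.exp_eq_exp]
        exact ⟨-toIcoDiv hp 0 t, by
          have h3 := toIcoMod_add_toIcoDiv_zsmul hp 0 t
          rw [zsmul_eq_mul] at h3
          push_cast
          linarith⟩
    · rintro ⟨t, ⟨h1, h2⟩, rfl⟩ h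
      have : Circle.exp t = 1 := by simpa using h
      rw [Circle.exp_eq_one] at this
      obtain ⟨k, hk⟩ := this
      have hp : (0 : ℝ) < 2 * Real.pi := by positivity
      rw [hk] at h1 h2
      have h3 : (0 : ℝ) < k := by
        by_contra h3
        push Not at h3
        nlinarith
      have h4 : (k : ℝ) < 1 := by
        by_contra h3
        push Not at h3
        nlinarith
      have h5 : (0 : ℤ) < k := by exact_mod_cast h3
      have h6 : k < (1 : ℤ) := by exact_mod_cast h4
      omega
  rw [this]
  exact isPreconnected_Ioo.image _ (by fun_prop)

theorem no_circle (S : Set X) : IsEmpty (S ≃ₜ Circle) := by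
  constructor
  intro e
  have hne : e.symm 1 ≠ e.symm (Circle.exp Real.pi) := by
    intro h
    have := e.symm.injective h
    have h2 : (1 : ℂ) = -1 := by
      have h3 := congrArg (fun z : Circle => (z : ℂ)) this
      simpa [Circle.coe_exp] using h3
    norm_num at h2
  have main : ∀ x y : S, (x : X) ⊓ y < x → False := by
    intro x y hxy
    obtain ⟨b, hb1, hb2⟩ := dense _ _ hxy
    have hby : ¬ b ≤ (y : X) := fun h => not_le_of_gt hb1 (le_inf hb2.le h)
    have hS : IsPreconnected S := by
      rw [isPreconnected_iff_preconnectedSpace]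
      haveI : PreconnectedSpace Circle := by
        refine ⟨?_⟩
        have : (univ : Set Circle) = range Circle.exp := Circle.exp_surjective.range_eq.symm
        rw [this]
        exact isPreconnected_range Circle.exp.continuous
      exact e.symm.surjective.denseRange.preconnectedSpace e.symm.continuous
    have hbS := separation hby hb2 hS x.2 y.2
    have hT : IsPreconnected ((fun z => ((e.symm z : S) : X)) '' ({e ⟨b, hbS⟩}ᶜ)) :=
      (circle_compl _).image _ (by fun_prop)
    have := separation hby hb2 hT ⟨e x, ?_, by simp⟩ ⟨e y, ?_, by simp⟩
    · obtain ⟨z, hz, hz2⟩ := this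
      apply hz
      have : e.symm z = ⟨b, hbS⟩ := Subtype.ext hz2
      rw [mem_singleton_iff, ← this]
      simp
    · intro h
      have := e.injective h
      rw [this] at hb2
      exact lt_irrefl _ hb2
    · intro h
      have := e.injective h
      rw [this] at hby
      exact hby le_rfl
  have hne' : ((e.symm 1 : S) : X) ≠ (e.symm (Circle.exp Real.pi) : S) := fun h => hne (Subtype.ext h)
  rcases exists_sep hne' with h | h
  · exact main _ _ h
  · rw [inf_comm] at h
    exact main _ _ h

open Classical in
theorem setComponents_eq (p : X) : setComponents X {p}ᶜ =
    (if p = ⊥ then ∅ else {dn p}) ∪ {C | ∃ x, p < x ∧ C = up p x} := by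
  ext C
  constructor
  · rintro ⟨x, hx, rfl⟩
    by_cases h : p ≤ x
    · have h2 := lt_of_le_of_ne h (fun h => hx h.symm)
      exact Or.inr ⟨x, h2, comp_up h2⟩
    · left
      have hp : p ≠ ⊥ := by
        rintro rfl
        exact h bot_le
      rw [if_neg hp, comp_dn h]
      rfl
  · rintro (h | ⟨x, hx, rfl⟩)
    · split_ifs at h with h1
      · exact absurd h (notMem_empty _)
      · rw [mem_singleton_iff] at h
        have h2 : ¬ p ≤ (⊥ : X) := fun h2 => h1 (le_bot_iff.1 h2)
        exact ⟨⊥, fun h2 => h1 h2.symm, by rw [h, comp_dn h2]⟩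
    · exact ⟨x, fun h => lt_irrefl _ (h ▸ hx), (comp_up hx).symm⟩

open Classical in
theorem count (p : X) {T : Type*} [Fintype T] (dir : X → T)
    (h1 : ∀ x y, p < x → p < y → (p < x ⊓ y ↔ dir x = dir y))
    (h2 : ∀ t, ∃ x, p < x ∧ dir x = t) :
    ptOrder X p = Fintype.card T + (if p = ⊥ then 0 else 1) := by
  choose r hr1 hr2 using h2
  have hup : {C | ∃ x, p < x ∧ C = up p x} = range (fun t => up p (r t)) := by
    ext C
    constructor
    · rintro ⟨x, hx, rfl⟩
      refine ⟨dir x, ?_⟩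
      have hxr : p < x ⊓ r (dir x) := (h1 _ _ hx (hr1 _)).2 (hr2 _).symm
      ext z
      constructor
      · intro hz
        have h3 : p < r (dir x) ⊓ z := by rwa [inf_comm]
        rw [inf_comm] at hxr
        have := inf_gt h3 hxr
        exact this
      · intro hz
        have h3 : p < x ⊓ z := by
          have hz' : p < z ⊓ x := hz
          rwa [inf_comm]
        exact inf_gt h3 hxr
    · rintro ⟨t, rfl⟩
      exact ⟨r t, hr1 t, rfl⟩
  have hinj : Function.Injective (fun t => up p (r t)) := by
    intro s t hst
    have : r s ∈ up p (r s) := by simpa [up] using hr1 s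
    simp only at hst
    rw [hst] at this
    have := (h1 _ _ (hr1 s) (hr1 t)).1 this
    rw [hr2, hr2] at this
    exact this
  have hcard : (range (fun t => up p (r t))).ncard = Fintype.card T := by
    rw [← image_univ, ncard_image_of_injective _ hinj, ncard_univ, Nat.card_eq_fintype_card]
  unfold ptOrder
  rw [setComponents_eq, hup]
  split_ifs with h
  · rw [empty_union, hcard, add_zero]
  · rw [ncard_union_eq, hcard, ncard_singleton, add_comm]
    · rw [Set.disjoint_left]
      rintro C hC ⟨t, rfl⟩
      rw [mem_singleton_iff] at hC
      have : r t ∈ up p (r t) := by simpa [up] using hr1 t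
      have h3 : r t ∈ dn p := by rw [← hC]; exact this
      exact h3 (hr1 t).le

end

end TreeLike


namespace TreeLike

section
variable {X : Type*} [TopologicalSpace X]

/-- The component of `x` in the complement of `p`. -/
abbrev comp (p x : X) : Set X := connectedComponentIn {p}ᶜ x

theorem mem_comp_self {p x : X} (h : x ≠ p) : x ∈ comp p x :=
  mem_connectedComponentIn h

theorem notMem_comp (p x : X) : p ∉ comp p x := fun h =>
  connectedComponentIn_subset _ _ h rfl

theorem comp_eq {p x z : X} (h : z ∈ comp p x) : comp p z = comp p x :=
  (connectedComponentIn_eq h).symm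

theorem comp_disj {p x y z : X} (hx : z ∈ comp p x) (hy : z ∈ comp p y) : comp p x = comp p y :=
  (comp_eq hx).symm.trans (comp_eq hy)

theorem image_comp (ψ : X ≃ₜ X) {p x : X} (h : x ≠ p) : ψ '' comp p x = comp (ψ p) (ψ x) := by
  have := ψ.image_connectedComponentIn (s := {p}ᶜ) (x := x) h
  rw [this]
  congr 1
  ext z
  simp only [mem_image, mem_compl_iff, mem_singleton_iff]
  constructor
  · rintro ⟨u, hu, rfl⟩ h
    exact hu (ψ.injective h)
  · intro hz
    refine ⟨ψ.symm z, fun h => hz ?_, by simp⟩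
    rw [← h]; simp

theorem apply_mem_comp (ψ : X ≃ₜ X) {p x z : X} (h : x ≠ p) :
    ψ z ∈ comp (ψ p) (ψ x) ↔ z ∈ comp p x := by
  rw [← image_comp ψ h]
  constructor
  · rintro ⟨u, hu, hu2⟩
    rwa [← ψ.injective hu2]
  · intro hz
    exact ⟨z, hz, rfl⟩

/-- The combined local transitivity property at `p`. -/
def SR (B : Set X) (G : Subgroup (X ≃ₜ X)) (p : X) : Prop :=
  ∀ x ∈ B, ∀ y ∈ B, x ≠ p → y ≠ p →
    ∃ g ∈ G, g x = y ∧ ∀ z, z ∉ comp p x → z ∉ comp p y → g z = z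

theorem inv_fix {g : X ≃ₜ X} {z : X} (h : g z = z) : g⁻¹ z = z := by
  conv_lhs => rw [← h]
  exact g.symm_apply_apply z

theorem inv_app (g : X ≃ₜ X) (z : X) : g⁻¹ (g z) = z := g.symm_apply_apply z

theorem app_inv (g : X ≃ₜ X) (z : X) : g (g⁻¹ z) = z := g.apply_symm_apply z

theorem SR_transport {B : Set X} {G : Subgroup (X ≃ₜ X)} (hinv : ∀ φ : X ≃ₜ X, ∀ b ∈ B, φ b ∈ B)
    {p0 : X} (h0 : SR B G p0) {g : X ≃ₜ X} (hg : g ∈ G) : SR B G (g p0) := by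
  intro x hx y hy hxp hyp
  have hx0 : g⁻¹ x ≠ p0 := fun h => hxp (by rw [← h, app_inv])
  have hy0 : g⁻¹ y ≠ p0 := fun h => hyp (by rw [← h, app_inv])
  obtain ⟨h, hh, hxy, hfix⟩ := h0 (g⁻¹ x) (hinv _ _ hx) (g⁻¹ y) (hinv _ _ hy) hx0 hy0
  refine ⟨g * h * g⁻¹, G.mul_mem (G.mul_mem hg hh) (G.inv_mem hg), ?_, ?_⟩
  · change g (h (g⁻¹ x)) = y
    rw [hxy, app_inv]
  · intro z hzx hzy
    change g (h (g⁻¹ z)) = z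
    rw [hfix, app_inv]
    · intro hc
      have := (apply_mem_comp g (z := g⁻¹ z) hx0).2 hc
      rw [app_inv, app_inv] at this
      exact hzx this
    · intro hc
      have := (apply_mem_comp g (z := g⁻¹ z) hy0).2 hc
      rw [app_inv, app_inv] at this
      exact hzy this

theorem swap_facts {p0 x p1 : X} {s : X ≃ₜ X} (hx : x ≠ p0) (hsx : s x ∈ comp p0 p1)
    (hfix : ∀ z, z ∉ comp p0 x → z ∉ comp p0 p1 → s z = z) (hne : comp p0 x ≠ comp p0 p1) :
    (∀ z ∈ comp p0 x, s z ∈ comp p0 p1) ∧ (∀ z ∈ comp p0 p1, s z ∈ comp p0 x) ∧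
    (∀ z ∈ comp p0 x, s⁻¹ z ∈ comp p0 p1) ∧ (∀ z ∈ comp p0 p1, s⁻¹ z ∈ comp p0 x) := by
  have hs0 : s p0 = p0 := hfix _ (notMem_comp _ _) (notMem_comp _ _)
  have hdis : ∀ z, z ∈ comp p0 x → z ∈ comp p0 p1 → False := fun z h1 h2 => hne (comp_disj h1 h2)
  have h1 : ∀ z, z ∈ comp p0 x ↔ s z ∈ comp p0 p1 := by
    intro z
    rw [← apply_mem_comp s hx, hs0, comp_eq hsx]
  have h2 : ∀ z ∈ comp p0 p1, s z ∈ comp p0 x := by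
    intro z hz
    by_contra hc
    have h3 : s z ∉ comp p0 p1 := fun h => hdis z ((h1 z).2 h) hz
    have h4 := hfix _ hc h3
    have h5 := s.injective h4
    rw [h5] at h3
    exact h3 hz
  refine ⟨fun z => (h1 z).1, h2, ?_, ?_⟩
  · intro z hz
    by_contra hc
    by_cases h3 : s⁻¹ z ∈ comp p0 x
    · have := (h1 _).1 h3
      rw [app_inv] at this
      exact hdis z hz this
    · have := hfix _ h3 hc
      rw [app_inv] at this
      rw [← this] at h3
      exact h3 hz
  · intro z hz
    rw [h1, app_inv]
    exact hz

theorem SR_of_swaps {B : Set X} {G : Subgroup (X ≃ₜ X)} (hinv : ∀ φ : X ≃ₜ X, ∀ b ∈ B, φ b ∈ B)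
    {p0 p1 : X}
    (hR : ∀ x ∈ B, ∀ y ∈ B, x ∈ comp p0 p1 → y ∈ comp p0 p1 →
      ∃ g ∈ G, g x = y ∧ ∀ z, z ∉ comp p0 p1 → g z = z)
    (hS : ∀ x, x ≠ p0 → ∃ s ∈ G, s x ∈ comp p0 p1 ∧
      ∀ z, z ∉ comp p0 x → z ∉ comp p0 p1 → s z = z) : SR B G p0 := by
  intro x hx y hy hxp hyp
  have hxx := mem_comp_self hxp
  have hyy := mem_comp_self hyp
  obtain ⟨s, hs, hsx, hsf⟩ := hS x hxp
  obtain ⟨t, ht, hty, htf⟩ := hS y hyp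
  by_cases hcx : comp p0 x = comp p0 p1
  · by_cases hcy : comp p0 y = comp p0 p1
    · obtain ⟨g, hg, hgx, hgf⟩ := hR x hx y hy (hcx ▸ hxx) (hcy ▸ hyy)
      exact ⟨g, hg, hgx, fun z hz _ => hgf z (hcx ▸ hz)⟩
    · obtain ⟨h, hh, hxy, hf⟩ := hR x hx (t y) (hinv _ _ hy) (hcx ▸ hxx) hty
      refine ⟨t⁻¹ * h, G.mul_mem (G.inv_mem ht) hh, ?_, ?_⟩
      · change t⁻¹ (h x) = y
        rw [hxy, inv_app]
      · intro z hz1 hz2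
        change t⁻¹ (h z) = z
        rw [hcx] at hz1
        rw [hf z hz1, inv_fix (htf z hz2 hz1)]
  · obtain ⟨sf1, sf2, sf3, sf4⟩ := swap_facts hxp hsx hsf hcx
    by_cases hcy : comp p0 y = comp p0 p1
    · obtain ⟨h, hh, hxy, hf⟩ := hR (s x) (hinv _ _ hx) y hy hsx (hcy ▸ hyy)
      refine ⟨h * s, G.mul_mem hh hs, hxy, ?_⟩
      intro z hz1 hz2
      change h (s z) = z
      rw [hcy] at hz2
      rw [hsf z hz1 hz2, hf z hz2]
    · by_cases hxy : comp p0 x = comp p0 y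
      · have hsy : s y ∈ comp p0 p1 := sf1 _ (hxy ▸ hyy)
        obtain ⟨h, hh, hxy', hf⟩ := hR (s x) (hinv _ _ hx) (s y) (hinv _ _ hy) hsx hsy
        refine ⟨s⁻¹ * h * s, G.mul_mem (G.mul_mem (G.inv_mem hs) hh) hs, ?_, ?_⟩
        · change s⁻¹ (h (s x)) = y
          rw [hxy', inv_app]
        · intro z hz1 hz2
          change s⁻¹ (h (s z)) = z
          have : s z ∉ comp p0 p1 := fun hc => by
            have := sf4 _ hc
            rw [inv_app] at this
            exact hz1 this
          rw [hf _ this, inv_app]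
      · obtain ⟨h, hh, hxy', hf⟩ := hR (s x) (hinv _ _ hx) (t y) (hinv _ _ hy) hsx hty
        refine ⟨s⁻¹ * t⁻¹ * h * s,
          G.mul_mem (G.mul_mem (G.mul_mem (G.inv_mem hs) (G.inv_mem ht)) hh) hs, ?_, ?_⟩
        · change s⁻¹ (t⁻¹ (h (s x))) = y
          rw [hxy', inv_app]
          exact inv_fix (hsf y (fun hc => hxy (comp_disj hc hyy)) (fun hc => hcy (comp_disj hyy hc)))
        · intro z hz1 hz2
          change s⁻¹ (t⁻¹ (h (s z))) = z
          by_cases hz0 : z ∈ comp p0 p1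
          · have h1 : s z ∈ comp p0 x := sf2 z hz0
            have h2 : s z ∉ comp p0 p1 := fun hc => hcx (comp_disj h1 hc)
            have h3 : s z ∉ comp p0 y := fun hc => hxy (comp_disj h1 hc)
            rw [hf _ h2, inv_fix (htf _ h3 h2), inv_app]
          · rw [hsf z hz1 hz0, hf z hz0, inv_fix (htf z hz2 hz0), inv_fix (hsf z hz1 hz0)]

end

section
variable {X : Type*} [TopologicalSpace X] [SemilatticeInf X] [OrderBot X] [TreeLike X]

theorem density {B : Set X} {G : Subgroup (X ≃ₜ X)} (hinv : ∀ φ : X ≃ₜ X, ∀ b ∈ B, φ b ∈ B)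
    (hT : ∀ x ∈ B, ∀ y ∈ B, ∃ g ∈ G, g x = y) (hSR : ∀ p ∈ B, SR B G p) (φ : X ≃ₜ X) :
    ∀ (k : ℕ) (E : Finset X), E.card = k → (E : Set X) ⊆ B → InfClosed (E : Set X) →
      ∃ g ∈ G, ∀ e ∈ E, g e = φ e := by
  classical
  intro k
  induction k with
  | zero =>
    intro E hE _ _
    rw [Finset.card_eq_zero] at hE
    subst hE
    exact ⟨1, G.one_mem, by simp⟩
  | succ k ih =>
    intro E hE hEB hEI
    have hne : E.Nonempty := by
      rw [← Finset.card_pos]; omega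
    obtain ⟨q, hqE, hqmax⟩ : ∃ q ∈ E, ∀ e ∈ E, q ≤ e → e = q := by
      obtain ⟨q, hq⟩ := E.exists_maximal hne
      exact ⟨q, hq.1, fun e he h => le_antisymm (hq.2 he h) h⟩
    have hE' : (E.erase q).card = k := by
      rw [Finset.card_erase_of_mem hqE]; omega
    have hsub : ((E.erase q : Finset X) : Set X) ⊆ B := fun e he =>
      hEB (Finset.mem_of_mem_erase he)
    obtain ⟨g, hg, hgE⟩ := ih (E.erase q) hE' hsub (by
      intro a ha b hb
      rw [Finset.mem_coe, Finset.mem_erase] at *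
      refine ⟨fun h => ha.1 (hqmax a ha.2 (h ▸ inf_le_left)), hEI ha.2 hb.2⟩)
    have hqB := hEB hqE
    rcases (E.erase q).eq_empty_or_nonempty with hemp | hnemp
    · obtain ⟨h, hh, hhq⟩ := hT q hqB (φ q) (hinv _ _ hqB)
      refine ⟨h, hh, fun e he => ?_⟩
      by_cases heq : e = q
      · rw [heq, hhq]
      · have : e ∈ E.erase q := Finset.mem_erase.2 ⟨heq, he⟩
        rw [hemp] at this
        simp at this
    · obtain ⟨p, hp⟩ := ((E.erase q).image (fun e => q ⊓ e)).exists_maximal (hnemp.image _)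
      obtain ⟨e0, he0, hpe⟩ := Finset.mem_image.1 hp.1
      have he0' := Finset.mem_erase.1 he0
      have hpq : p ≠ q := fun h => he0'.1 (hqmax e0 he0'.2 (by
        rw [← h, ← hpe]; exact inf_le_right))
      have hpE : p ∈ E.erase q := Finset.mem_erase.2 ⟨hpq, by
        rw [← hpe]; exact hEI hqE he0'.2⟩
      have hplt : p < q := lt_of_le_of_ne (by rw [← hpe]; exact inf_le_left) hpq
      set ψ : X ≃ₜ X := g⁻¹ * φ with hψ
      have hψE : ∀ e ∈ E.erase q, ψ e = e := by
        intro e he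
        change g⁻¹ (φ e) = e
        rw [← hgE e he, inv_app]
      have hψp := hψE p hpE
      have hψq : ψ q ≠ p := by
        intro h
        rw [← hψp] at h
        exact hpq (ψ.injective h).symm
      obtain ⟨h, hh, hhq, hhf⟩ := hSR p (hsub hpE) q hqB (ψ q) (hinv _ _ hqB) hpq.symm hψq
      have hnot : ∀ e ∈ E.erase q, e ∉ comp p q := by
        intro e he hc
        rw [comp, comp_up hplt] at hc
        have hc' : p < e ⊓ q := hc
        rw [inf_comm] at hc'
        exact absurd (hp.2 (Finset.mem_image_of_mem _ he) hc'.le) (not_le_of_gt hc')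
      have hnot2 : ∀ e ∈ E.erase q, e ∉ comp p (ψ q) := by
        intro e he hc
        have := (apply_mem_comp ψ (p := p) (x := q) (z := e) hpq.symm).1 (by
          rw [hψp, hψE e he]; exact hc)
        exact hnot e he this
      refine ⟨g * h, G.mul_mem hg hh, fun e he => ?_⟩
      change g (h e) = φ e
      by_cases heq : e = q
      · rw [heq, hhq]
        change g (g⁻¹ (φ q)) = φ q
        rw [app_inv]
      · have he' : e ∈ E.erase q := Finset.mem_erase.2 ⟨heq, he⟩
        rw [hhf e (hnot e he') (hnot2 e he'), hgE e he']

theorem density' {B : Set X} (hBI : InfClosed B) {G : Subgroup (X ≃ₜ X)}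
    (hinv : ∀ φ : X ≃ₜ X, ∀ b ∈ B, φ b ∈ B)
    (hT : ∀ x ∈ B, ∀ y ∈ B, ∃ g ∈ G, g x = y) {p0 : X} (hp0 : p0 ∈ B) (hSR : SR B G p0)
    (φ : X ≃ₜ X) (F : Set X) (hF : F.Finite) (hFB : F ⊆ B) :
    ∃ g ∈ G, ∀ e ∈ F, g e = φ e := by
  have hfin : (infClosure F).Finite := hF.infClosure
  have hall : ∀ p ∈ B, SR B G p := by
    intro p hp
    obtain ⟨g, hg, rfl⟩ := hT p0 hp0 p hp
    exact SR_transport hinv hSR hg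
  obtain ⟨g, hg, hgE⟩ := density hinv hT hall φ _ hfin.toFinset rfl (by
    rw [hfin.coe_toFinset]
    exact infClosure_min hFB hBI) (by
    rw [hfin.coe_toFinset]
    exact infClosed_infClosure)
  exact ⟨g, hg, fun e he => hgE e (by
    rw [hfin.mem_toFinset]; exact subset_infClosure he)⟩

end

end TreeLike

theorem ptOrder_homeo {X : Type*} [TopologicalSpace X] (φ : X ≃ₜ X) (p : X) :
    ptOrder X (φ p) = ptOrder X p := by
  have : setComponents X {φ p}ᶜ = (fun C => φ '' C) '' setComponents X {p}ᶜ := by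
    ext C
    constructor
    · rintro ⟨x, hx, rfl⟩
      have hx' : φ.symm x ≠ p := fun h => hx (by rw [← h]; simp)
      refine ⟨_, ⟨φ.symm x, hx', rfl⟩, ?_⟩
      have := TreeLike.image_comp φ hx'
      rw [φ.apply_symm_apply] at this
      exact this
    · rintro ⟨_, ⟨x, hx, rfl⟩, rfl⟩
      exact ⟨φ x, fun h => hx (φ.injective h), TreeLike.image_comp φ hx⟩
  unfold ptOrder
  rw [this]
  exact Set.ncard_image_of_injective _ (Set.image_injective.2 φ.injective)


namespace Waz

/-- Dyadic rationals. -/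
def Dy : Set ℝ := {x | ∃ (m : ℤ) (k : ℕ), x = m / 2 ^ k}

instance : Countable Dy := by
  have : Dy = range (fun p : ℤ × ℕ => (p.1 : ℝ) / 2 ^ p.2) := by
    ext x
    simp only [Dy, mem_ofPred_eq, mem_range, Prod.exists]
    constructor
    · rintro ⟨m, k, h⟩
      exact ⟨m, k, h.symm⟩
    · rintro ⟨m, k, h⟩
      exact ⟨m, k, h.symm⟩
  rw [this]
  exact (countable_range _).to_subtype

theorem dy_int (m : ℤ) : (m : ℝ) ∈ Dy := ⟨m, 0, by simp⟩

theorem dy_dense {a b : ℝ} (h : a < b) : ∃ d ∈ Dy, a < d ∧ d < b := by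
  obtain ⟨k, hk⟩ := exists_nat_gt (1 / (b - a))
  have hba : 0 < b - a := sub_pos.2 h
  have h2k : (k : ℝ) < 2 ^ k := by exact_mod_cast Nat.lt_two_pow_self
  have hpos : (0 : ℝ) < 2 ^ k := by positivity
  have h1 : 1 < (b - a) * 2 ^ k := by
    have : 1 < k * (b - a) := by rwa [div_lt_iff₀ hba] at hk
    nlinarith
  refine ⟨(⌊a * 2 ^ k⌋ + 1 : ℤ) / 2 ^ k, ⟨_, k, rfl⟩, ?_, ?_⟩
  · rw [lt_div_iff₀ hpos]
    push_cast
    exact Int.lt_floor_add_one _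
  · rw [div_lt_iff₀ hpos]
    push_cast
    have := Int.floor_le (a * 2 ^ k)
    nlinarith

theorem dy_dense_E {a b : EReal} (h : a < b) : ∃ d ∈ Dy, a < (d : EReal) ∧ (d : EReal) < b := by
  obtain ⟨c, hac, hcb⟩ := exists_between h
  obtain ⟨c', hac', hcb'⟩ := exists_between hac
  have hc : c ≠ ⊤ := ne_top_of_lt hcb
  have hc1 : c ≠ ⊥ := ne_bot_of_gt hac
  have hc' : c' ≠ ⊤ := ne_top_of_lt hcb'
  have hc1' : c' ≠ ⊥ := ne_bot_of_gt hac'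
  lift c to ℝ using ⟨hc, hc1⟩
  lift c' to ℝ using ⟨hc', hc1'⟩
  obtain ⟨d, hd, h1, h2⟩ := dy_dense (EReal.coe_lt_coe_iff.1 hcb')
  exact ⟨d, hd, hac'.trans (EReal.coe_lt_coe_iff.2 h1), (EReal.coe_lt_coe_iff.2 h2).trans hcb⟩

/-- Letters. -/
abbrev Lt (m : ℕ) := Dy × Fin m

variable {m : ℕ}

/-- The value of a letter. -/
def vl (l : Lt m) : EReal := ((l.1 : ℝ) : EReal)

theorem vl_ne_bot (l : Lt m) : vl l ≠ ⊥ := EReal.coe_ne_bot _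
theorem vl_ne_top (l : Lt m) : vl l ≠ ⊤ := EReal.coe_ne_top _

/-- Base value of a coordinate. -/
noncomputable def bs : List (Lt m) → EReal
  | [] => ⊥
  | _ :: _ => 0

theorem bs_of_ne {w : List (Lt m)} (h : w ≠ []) : bs w = 0 := by
  cases w with
  | nil => exact absurd rfl h
  | cons a w => rfl

theorem bs_le_of {w : List (Lt m)} {t : EReal} (h : w ≠ [] → 0 ≤ t) : bs w ≤ t := by
  cases w with
  | nil => exact bot_le
  | cons a w => exact h (by simp)

/-- Coordinates of points of the dendrite. -/
structure Good (x : List (Lt m) → EReal) : Prop where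
  val : ∀ w l, x (w ++ [l]) ≠ 0 → x w = vl l
  uniq : ∀ w l l', x (w ++ [l]) ≠ 0 → x (w ++ [l']) ≠ 0 → l = l'
  nonneg : ∀ w, w ≠ [] → 0 ≤ x w
  pos : ∀ w l, w ≠ [] → x (w ++ [l]) ≠ 0 → 0 < vl l

variable (m) in
/-- The dendrite. -/
abbrev W := {x : List (Lt m) → EReal // Good x}

theorem isClosed_imp' {Y : Type*} [TopologicalSpace Y] {p q : Y → Prop} (hp : IsOpen {y | p y})
    (hq : IsClosed {y | q y}) : IsClosed {y | p y → q y} := by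
  have : {y | p y → q y} = {y | p y}ᶜ ∪ {y | q y} := by
    ext y
    simp only [mem_ofPred_eq, mem_union, mem_compl_iff]
    tauto
  rw [this]
  exact hp.isClosed_compl.union hq

theorem isOpen_ne' (w : List (Lt m)) : IsOpen {x : List (Lt m) → EReal | x w ≠ 0} :=
  isOpen_ne.preimage (continuous_apply w)

theorem isClosed_good : IsClosed {x : List (Lt m) → EReal | Good x} := by
  have : {x : List (Lt m) → EReal | Good x} =
      ({x | ∀ w l, x (w ++ [l]) ≠ 0 → x w = vl l} ∩
       {x | ∀ w l l', x (w ++ [l]) ≠ 0 → x (w ++ [l']) ≠ 0 → l = l'}) ∩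
      ({x | ∀ w, w ≠ [] → 0 ≤ x w} ∩ {x | ∀ w l, w ≠ [] → x (w ++ [l]) ≠ 0 → 0 < vl l}) := by
    ext x
    constructor
    · rintro ⟨h1, h2, h3, h4⟩
      exact ⟨⟨h1, h2⟩, h3, h4⟩
    · rintro ⟨⟨h1, h2⟩, h3, h4⟩
      exact ⟨h1, h2, h3, h4⟩
  rw [this]
  refine IsClosed.inter (IsClosed.inter ?_ ?_) (IsClosed.inter ?_ ?_)
  · simp only [ofPred_forall]
    refine isClosed_iInter fun w => isClosed_iInter fun l => isClosed_imp' (isOpen_ne' _) ?_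
    exact isClosed_eq (continuous_apply _) continuous_const
  · simp only [ofPred_forall]
    refine isClosed_iInter fun w => isClosed_iInter fun l => isClosed_iInter fun l' =>
      isClosed_imp' (isOpen_ne' _) (isClosed_imp' (isOpen_ne' _) isClosed_const)
  · simp only [ofPred_forall]
    refine isClosed_iInter fun w => isClosed_iInter fun _ => ?_
    exact isClosed_le continuous_const (continuous_apply _)
  · simp only [ofPred_forall]
    refine isClosed_iInter fun w => isClosed_iInter fun l => isClosed_iInter fun _ =>
      isClosed_imp' (isOpen_ne' _) isClosed_const

theorem Good.inf {x y : List (Lt m) → EReal} (hx : Good x) (hy : Good y) : Good (x ⊓ y) := by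
  have key : ∀ w l, (x ⊓ y) (w ++ [l]) ≠ 0 → x (w ++ [l]) ≠ 0 ∧ y (w ++ [l]) ≠ 0 := by
    intro w l h
    have h1 := hx.nonneg (w ++ [l]) (by simp)
    have h2 := hy.nonneg (w ++ [l]) (by simp)
    constructor
    · intro h3
      apply h
      rw [Pi.inf_apply, h3, inf_eq_left.2 h2]
    · intro h3
      apply h
      rw [Pi.inf_apply, h3, inf_eq_right.2 h1]
  refine ⟨?_, ?_, ?_, ?_⟩
  · intro w l h
    obtain ⟨h1, h2⟩ := key w l h
    rw [Pi.inf_apply, hx.val w l h1, hy.val w l h2, inf_idem]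
  · intro w l l' h h'
    exact hx.uniq w l l' (key w l h).1 (key w l' h').1
  · intro w hw
    exact le_inf (hx.nonneg w hw) (hy.nonneg w hw)
  · intro w l hw h
    exact hx.pos w l hw (key w l h).1

noncomputable instance : SemilatticeInf (W m) :=
  Subtype.semilatticeInf fun _ _ hx hy => Good.inf hx hy

theorem good_bs : Good (bs : List (Lt m) → EReal) := by
  refine ⟨?_, ?_, ?_, ?_⟩
  · intro w l h
    exact absurd (bs_of_ne (by simp)) h
  · intro w l l' h
    exact absurd (bs_of_ne (by simp)) h
  · intro w h
    rw [bs_of_ne h]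
  · intro w l _ h
    exact absurd (bs_of_ne (by simp)) h

theorem bs_le (x : W m) (w : List (Lt m)) : bs w ≤ x.1 w := bs_le_of (x.2.nonneg w)

noncomputable instance : OrderBot (W m) where
  bot := ⟨bs, good_bs⟩
  bot_le x := fun w => bs_le x w

theorem bot_apply (w : List (Lt m)) : (⊥ : W m).1 w = bs w := rfl

theorem inf_apply (x y : W m) (w : List (Lt m)) : (x ⊓ y).1 w = x.1 w ⊓ y.1 w := rfl

/-! Structure of supports. -/

theorem ne_of_ext (x : W m) (w : List (Lt m)) (l : Lt m) (v : List (Lt m)) :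
    x.1 (w ++ l :: v) ≠ 0 → x.1 (w ++ [l]) ≠ 0 := by
  induction v using List.reverseRecOn with
  | nil => exact id
  | append_singleton v l' ih =>
    intro h
    apply ih
    have h' : x.1 ((w ++ l :: v) ++ [l']) ≠ 0 := by simpa using h
    rw [x.2.val _ _ h']
    exact (x.2.pos _ _ (by simp) h').ne'

theorem val_of_ext (x : W m) {w : List (Lt m)} {l : Lt m} {v : List (Lt m)}
    (h : x.1 (w ++ l :: v) ≠ 0) : x.1 w = vl l :=
  x.2.val _ _ (ne_of_ext x w l v h)

theorem list_tri {α : Type*} (v w : List α) : v <+: w ∨ w <+: v ∨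
    ∃ u l l' v' w', l ≠ l' ∧ v = u ++ l :: v' ∧ w = u ++ l' :: w' := by
  induction v generalizing w with
  | nil => exact Or.inl (List.nil_prefix)
  | cons a v ih =>
    cases w with
    | nil => exact Or.inr (Or.inl List.nil_prefix)
    | cons b w =>
      by_cases hab : a = b
      · subst hab
        rcases ih w with h | h | ⟨u, l, l', v', w', hl, h1, h2⟩
        · exact Or.inl (by simpa using h)
        · exact Or.inr (Or.inl (by simpa using h))
        · exact Or.inr (Or.inr ⟨a :: u, l, l', v', w', hl, by simp [h1], by simp [h2]⟩)
      · exact Or.inr (Or.inr ⟨[], a, b, v, w, hab, rfl, rfl⟩)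

theorem supp_cmp (x : W m) {v w : List (Lt m)} (hv : x.1 v ≠ bs v) (hw : x.1 w ≠ bs w) :
    v <+: w ∨ w <+: v := by
  rcases list_tri v w with h | h | ⟨u, l, l', v', w', hl, rfl, rfl⟩
  · exact Or.inl h
  · exact Or.inr h
  · rw [bs_of_ne (by simp)] at hv hw
    exact absurd (x.2.uniq u l l' (ne_of_ext x _ _ _ hv) (ne_of_ext x _ _ _ hw)) hl

theorem prefix_cases {α : Type*} {v w : List α} (h : v <+: w) : v = w ∨ ∃ l u, w = v ++ l :: u := by
  obtain ⟨s, rfl⟩ := h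
  cases s with
  | nil => exact Or.inl (by simp)
  | cons l u => exact Or.inr ⟨l, u, rfl⟩

theorem chain_aux {x y z : W m} (hy : y ≤ x) (hz : z ≤ x) {a b : List (Lt m)}
    (ha : z.1 a < y.1 a) (hb : y.1 b < z.1 b) {l u} (hab : a = b ++ l :: u) : False := by
  subst hab
  have h0 : (0 : EReal) < y.1 (b ++ l :: u) := lt_of_le_of_lt (z.2.nonneg _ (by simp)) ha
  have h1 : y.1 b = vl l := val_of_ext y h0.ne'
  have h2 : x.1 b = vl l := val_of_ext x (h0.trans_le (hy _)).ne'
  have h3 := hz b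
  rw [h2, ← h1] at h3
  exact absurd h3 (not_le_of_gt hb)

theorem chain_W (x y z : W m) (hy : y ≤ x) (hz : z ≤ x) : y ≤ z ∨ z ≤ y := by
  by_contra hc
  push Not at hc
  obtain ⟨h1, h2⟩ := hc
  obtain ⟨a, ha⟩ : ∃ a, z.1 a < y.1 a := by
    by_contra hc
    push Not at hc
    exact h1 hc
  obtain ⟨b, hb⟩ : ∃ a, y.1 a < z.1 a := by
    by_contra hc
    push Not at hc
    exact h2 hc
  have hxa : x.1 a ≠ bs a := ((bs_le z a).trans_lt (ha.trans_le (hy a))).ne'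
  have hxb : x.1 b ≠ bs b := ((bs_le y b).trans_lt (hb.trans_le (hz b))).ne'
  rcases supp_cmp x hxa hxb with h | h
  · rcases prefix_cases h with h | ⟨l, u, h⟩
    · subst h
      exact lt_asymm ha hb
    · exact chain_aux hz hy hb ha h
  · rcases prefix_cases h with h | ⟨l, u, h⟩
    · subst h
      exact lt_asymm ha hb
    · exact chain_aux hy hz ha hb h

open Classical in
/-- The point at value `t` on the arm `w`. -/
noncomputable def P : List (Lt m) → EReal → List (Lt m) → EReal
  | [], t, [] => t
  | [], _, _ :: _ => 0
  | l :: _, _, [] => vl l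
  | l :: w, t, l' :: v => if l' = l then P w t v else 0

theorem P_cases (w : List (Lt m)) (t : EReal) (v : List (Lt m)) :
    (v = w ∧ P w t v = t) ∨ (∃ l u, w = v ++ l :: u ∧ P w t v = vl l) ∨
      (v ≠ [] ∧ ¬ v <+: w ∧ P w t v = 0) := by
  induction w generalizing v with
  | nil =>
    cases v with
    | nil => exact Or.inl ⟨rfl, by simp [P]⟩
    | cons a v => exact Or.inr (Or.inr ⟨by simp, by simp, by simp [P]⟩)
  | cons b w ih =>
    cases v with
    | nil => exact Or.inr (Or.inl ⟨b, w, rfl, by simp [P]⟩)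
    | cons a v =>
      by_cases hab : a = b
      · subst hab
        have hP : P (a :: w) t (a :: v) = P w t v := by simp [P]
        rcases ih v with ⟨h1, h2⟩ | ⟨l, u, h1, h2⟩ | ⟨h1, h2, h3⟩
        · exact Or.inl ⟨by rw [h1], by rw [hP, h2]⟩
        · exact Or.inr (Or.inl ⟨l, u, by rw [h1]; rfl, by rw [hP, h2]⟩)
        · exact Or.inr (Or.inr ⟨by simp, by simpa using h2, by rw [hP, h3]⟩)
      · exact Or.inr (Or.inr ⟨by simp, by simp [hab], by simp [P, hab]⟩)

theorem P_self (w : List (Lt m)) (t : EReal) : P w t w = t := by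
  rcases P_cases w t w with ⟨_, h⟩ | ⟨l, u, h, _⟩ | ⟨_, h, _⟩
  · exact h
  · have := congrArg List.length h
    simp at this
  · exact absurd (List.prefix_refl w) h

theorem P_ext (w : List (Lt m)) (t : EReal) (l : Lt m) : P w t (w ++ [l]) = 0 := by
  rcases P_cases w t (w ++ [l]) with ⟨h, _⟩ | ⟨l, u, h, _⟩ | ⟨_, _, h⟩
  · have := congrArg List.length h
    simp at this
  · have := congrArg List.length h
    simp at this
  · exact h

/-- Validity of a word. -/
def Val (w : List (Lt m)) : Prop := ∀ u l v, w = u ++ l :: v → u ≠ [] → 0 < vl l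

theorem Val_of (x : W m) {w : List (Lt m)} (h : x.1 w ≠ bs w) : Val w := by
  rintro u l v rfl hu
  rw [bs_of_ne (by simp)] at h
  exact x.2.pos u l hu (ne_of_ext x u l v h)

theorem Val_snoc {w : List (Lt m)} (h : Val w) {l : Lt m} (hl : bs w < vl l) : Val (w ++ [l]) := by
  intro u l' v huv hu
  rcases List.eq_nil_or_concat v with rfl | ⟨v', a, rfl⟩
  · have := List.append_inj' huv rfl
    obtain ⟨h1, h2⟩ := this
    subst h1
    simp at h2
    subst h2
    rwa [bs_of_ne hu] at hl
  · have h2 : w ++ [l] = (u ++ l' :: v') ++ [a] := by simpa using huv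
    exact h u l' v' (List.append_inj' h2 rfl).1 hu

theorem good_P {w : List (Lt m)} {t : EReal} (hw : Val w) (ht : w ≠ [] → 0 ≤ t) : Good (P w t) := by
  have pre : ∀ v, v ≠ [] → P w t v ≠ 0 → v <+: w := by
    intro v _ h
    rcases P_cases w t v with ⟨h1, _⟩ | ⟨l, u, h1, _⟩ | ⟨_, _, h1⟩
    · rw [h1]
    · rw [h1]; exact List.prefix_append _ _
    · exact absurd h1 h
  have val : ∀ v l, (v ++ [l]) <+: w → P w t v = vl l := by
    intro v l h
    obtain ⟨s, hs⟩ := h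
    rcases P_cases w t v with ⟨h1, _⟩ | ⟨l', u, h1, h2⟩ | ⟨_, h1, _⟩
    · have := congrArg List.length hs
      rw [h1] at this
      simp at this
    · rw [h2]
      rw [h1] at hs
      simp at hs
      rw [hs.1]
    · exact absurd ⟨l :: s, by simpa using hs⟩ h1
  refine ⟨?_, ?_, ?_, ?_⟩
  · intro v l h
    exact val v l (pre _ (by simp) h)
  · intro v l l' h h'
    obtain ⟨s, hs⟩ := pre _ (by simp) h
    obtain ⟨s', hs'⟩ := pre _ (by simp) h'
    have := hs.trans hs'.symm
    simp at this
    exact this.1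
  · intro v hv
    rcases P_cases w t v with ⟨h1, h2⟩ | ⟨l, u, h1, h2⟩ | ⟨_, _, h1⟩
    · rw [h2]
      exact ht (h1 ▸ hv)
    · rw [h2]
      exact (hw v l u h1 hv).le
    · rw [h1]
  · intro v l hv h
    obtain ⟨s, hs⟩ := pre _ (by simp) h
    exact hw v l s (by rw [← hs]; simp) hv

/-- The point with given coordinates. -/
noncomputable def pt {w : List (Lt m)} {t : EReal} (hw : Val w) (ht : w ≠ [] → 0 ≤ t) : W m :=
  ⟨P w t, good_P hw ht⟩

theorem P_le (x : W m) {w : List (Lt m)} {t : EReal} (h1 : x.1 w ≠ bs w) (h2 : t ≤ x.1 w)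
    (v : List (Lt m)) : P w t v ≤ x.1 v := by
  rcases P_cases w t v with ⟨h, h3⟩ | ⟨l, u, h, h3⟩ | ⟨h, _, h3⟩
  · rw [h3, h]; exact h2
  · rw [h3]
    rw [h, bs_of_ne (by simp)] at h1
    rw [val_of_ext x h1]
  · rw [h3]
    exact x.2.nonneg v h

theorem eq_P (x : W m) {w : List (Lt m)} (h1 : x.1 w ≠ bs w)
    (h2 : ∀ l, x.1 (w ++ [l]) = 0) : x.1 = P w (x.1 w) := by
  funext v
  rcases P_cases w (x.1 w) v with ⟨h, h3⟩ | ⟨l, u, h, h3⟩ | ⟨h, h4, h3⟩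
  · rw [h3, h]
  · rw [h3]
    rw [h, bs_of_ne (by simp)] at h1
    exact val_of_ext x h1
  · rw [h3]
    by_contra hc
    rcases supp_cmp x (v := v) (by rwa [bs_of_ne h]) h1 with h5 | h5
    · exact h4 h5
    · rcases prefix_cases h5 with h6 | ⟨l, u, h6⟩
      · exact h4 (h6 ▸ List.prefix_refl _)
      · rw [h6] at hc
        exact ne_of_ext x _ _ _ hc (h2 l)

/-- Branch points. -/
def IsBr (x : W m) : Prop := ∃ (w : List (Lt m)) (d : Dy), x.1 w = ((d : ℝ) : EReal) ∧
  bs w < x.1 w ∧ ∀ l, x.1 (w ++ [l]) = 0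

theorem dense_Br (y z : W m) (h : y < z) : ∃ b, IsBr b ∧ y < b ∧ b < z := by
  obtain ⟨a, ha⟩ : ∃ a, y.1 a < z.1 a := by
    by_contra hc
    push Not at hc
    exact not_le_of_gt h hc
  obtain ⟨d, hd, h1, h2⟩ := dy_dense_E ha
  have hza : z.1 a ≠ bs a := ((bs_le y a).trans_lt ha).ne'
  have hbd : bs a < (d : EReal) := (bs_le y a).trans_lt h1
  let b : W m := pt (w := a) (t := (d : EReal)) (Val_of z hza) (fun hn => by
    rw [← bs_of_ne hn]; exact hbd.le)
  have hba : b.1 a = (d : EReal) := P_self _ _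
  have hbz : b ≤ z := P_le z hza h2.le
  refine ⟨b, ⟨a, ⟨d, hd⟩, hba, by rw [hba]; exact hbd, fun l => P_ext _ _ _⟩, ?_, ?_⟩
  · rcases chain_W z y b h.le hbz with h3 | h3
    · exact lt_of_le_of_ne h3 (fun h4 => by rw [← h4] at hba; exact h1.ne hba)
    · have := h3 a
      rw [hba] at this
      exact absurd this (not_le_of_gt h1)
  · exact lt_of_le_of_ne hbz (fun h4 => by rw [h4] at hba; exact h2.ne hba.symm)

instance : TreeLike (W m) where
  compact := isCompact_iff_compactSpace.1 (isClosed_good (m := m)).isCompact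
  t2 := inferInstance
  ocl := inferInstance
  cinf := by
    refine Continuous.subtype_mk (f := fun p : W m × W m => p.1.1 ⊓ p.2.1) ?_ _
    refine continuous_pi fun w => ?_
    exact (((continuous_apply w).comp continuous_subtype_val).comp continuous_fst).min
      (((continuous_apply w).comp continuous_subtype_val).comp continuous_snd)
  chain := chain_W
  dense := fun y z h => by
    obtain ⟨b, _, h1, h2⟩ := dense_Br y z h
    exact ⟨b, h1, h2⟩

theorem lt_iff_exists {p x : W m} (h : p ≤ x) : p < x ↔ ∃ a, p.1 a < x.1 a := by
  constructor
  · intro h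
    by_contra hc
    push Not at hc
    exact not_le_of_gt h hc
  · rintro ⟨a, ha⟩
    exact lt_of_le_of_ne h (fun h2 => by rw [h2] at ha; exact lt_irrefl _ ha)

theorem eq_bot_of (x : W m) (h : x.1 [] = ⊥) : x = ⊥ := by
  apply Subtype.ext
  funext v
  rw [bot_apply]
  cases v with
  | nil => exact h
  | cons l v =>
    by_contra hc
    have := val_of_ext x (w := []) hc
    rw [h] at this
    exact vl_ne_bot l this.symm

theorem zero_of_lt {p x : W m} (h : p ≤ x) {a : List (Lt m)} (ha : p.1 a < x.1 a) (l : Lt m) :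
    p.1 (a ++ [l]) = 0 := by
  by_contra hc
  have h1 : 0 < p.1 (a ++ [l]) := lt_of_le_of_ne (p.2.nonneg _ (by simp)) (Ne.symm hc)
  have h2 := x.2.val a l (h1.trans_le (h _)).ne'
  have h3 := p.2.val a l hc
  rw [h2, h3] at ha
  exact lt_irrefl _ ha

theorem classify_aux {p x : W m} (h : p ≤ x) (a : List (Lt m)) (ha : p.1 a < x.1 a) :
    p = ⊥ ∨ ∃ w, bs w < p.1 w ∧ p.1 w < ⊤ ∧ ∀ l, p.1 (w ++ [l]) = 0 := by
  induction a using List.reverseRecOn with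
  | nil =>
    by_cases hp : p.1 [] = ⊥
    · exact Or.inl (eq_bot_of p hp)
    · exact Or.inr ⟨[], bot_lt_iff_ne_bot.2 hp, ha.trans_le le_top, zero_of_lt h ha⟩
  | append_singleton u l ih =>
    by_cases hp : p.1 (u ++ [l]) = 0
    · have hx : x.1 (u ++ [l]) ≠ 0 := by
        rw [hp] at ha
        exact ha.ne'
      have hxu := x.2.val _ _ hx
      rcases (h u).lt_or_eq with h1 | h1
      · exact ih h1
      · have hpu := h1.trans hxu
        refine Or.inr ⟨u, ?_, ?_, ?_⟩
        · rw [hpu]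
          by_cases hu : u = []
          · rw [hu]; exact bot_lt_iff_ne_bot.2 (vl_ne_bot l)
          · rw [bs_of_ne hu]
            exact x.2.pos u l hu hx
        · rw [hpu]; exact lt_top_iff_ne_top.2 (vl_ne_top l)
        · intro l'
          by_contra hc
          have h2 : 0 < p.1 (u ++ [l']) := lt_of_le_of_ne (p.2.nonneg _ (by simp)) (Ne.symm hc)
          have h3 := x.2.uniq u l' l (h2.trans_le (h _)).ne' hx
          rw [h3] at hc
          exact hc hp
    · refine Or.inr ⟨u ++ [l], ?_, ha.trans_le le_top, zero_of_lt h ha⟩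
      rw [bs_of_ne (by simp)]
      exact lt_of_le_of_ne (p.2.nonneg _ (by simp)) (Ne.symm hp)

theorem dirs {p x : W m} (h : p < x) {w : List (Lt m)} (h1 : bs w < p.1 w)
    (h2 : ∀ l, p.1 (w ++ [l]) = 0) :
    p.1 w < x.1 w ∨ ∃ l, vl l = p.1 w ∧ x.1 (w ++ [l]) ≠ 0 := by
  rcases (h.le w).lt_or_eq with h3 | h3
  · exact Or.inl h3
  · right
    obtain ⟨a, ha⟩ := (lt_iff_exists h.le).1 h
    have hpP := eq_P p h1.ne' h2
    have hxw : x.1 w ≠ bs w := by rw [← h3]; exact h1.ne'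
    rcases P_cases w (p.1 w) a with ⟨h4, _⟩ | ⟨l, u, h4, h5⟩ | ⟨h4, h5, h6⟩
    · rw [h4, h3] at ha
      exact absurd ha (lt_irrefl _)
    · rw [← hpP] at h5
      have h6 : x.1 a = vl l := val_of_ext x (v := u) (by
        rw [← h4]
        rwa [bs_of_ne (by rw [h4]; simp)] at hxw)
      rw [h5, h6] at ha
      exact absurd ha (lt_irrefl _)
    · rw [← hpP] at h6
      rw [h6] at ha
      rcases supp_cmp x (v := a) (by rw [bs_of_ne h4]; exact ha.ne') hxw with h7 | h7
      · exact absurd h7 h5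
      · rcases prefix_cases h7 with h8 | ⟨l, u, h8⟩
        · exact absurd (h8 ▸ List.prefix_refl _) h5
        · rw [h8] at ha
          have h9 := ne_of_ext x _ _ _ ha.ne'
          exact ⟨l, by rw [h3, x.2.val _ _ h9], h9⟩

theorem nonbranch {p : W m} {w : List (Lt m)} (h1 : bs w < p.1 w) (h3 : p.1 w < ⊤)
    (h2 : ∀ l, p.1 (w ++ [l]) = 0) (hb : ¬ IsBr p) {x : W m} (h : p < x) : p.1 w < x.1 w := by
  rcases dirs h h1 h2 with h4 | ⟨l, h4, _⟩
  · exact h4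
  · exact absurd ⟨w, l.1, h4.symm, h1, h2⟩ hb

theorem bot_lt_apply {x : W m} (h : ⊥ < x) : ⊥ < x.1 [] :=
  bot_lt_iff_ne_bot.2 (fun hc => h.ne' (eq_bot_of x hc))

theorem inf_bot {x y : W m} (hx : ⊥ < x) (hy : ⊥ < y) : ⊥ < x ⊓ y := by
  rw [bot_lt_iff_ne_bot]
  intro hc
  have h1 := congrArg (fun z : W m => z.1 []) hc
  simp only [inf_apply, bot_apply] at h1
  have h2 : ⊥ < x.1 [] ⊓ y.1 [] := lt_inf_iff.2 ⟨bot_lt_apply hx, bot_lt_apply hy⟩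
  rw [h1] at h2
  exact lt_irrefl _ h2

theorem inf_lt {p x y : W m} (hx : p < x) (hy : p < y) {w : List (Lt m)} (h1 : p.1 w < x.1 w)
    (h2 : p.1 w < y.1 w) : p < x ⊓ y :=
  (lt_iff_exists (le_inf hx.le hy.le)).2 ⟨w, lt_inf_iff.2 ⟨h1, h2⟩⟩

theorem isBr_of_two {p x y : W m} (hx : p < x) (hy : p < y) (h : ¬ p < x ⊓ y) : IsBr p := by
  by_contra hb
  obtain ⟨a, ha⟩ := (lt_iff_exists hx.le).1 hx
  rcases classify_aux hx.le a ha with rfl | ⟨w, h1, h2, h3⟩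
  · exact h (inf_bot hx hy)
  · exact h (inf_lt hx hy (nonbranch h1 h2 h3 hb hx) (nonbranch h1 h2 h3 hb hy))

theorem infClosed_Br : InfClosed {x : W m | IsBr x} := by
  intro x hx y hy
  by_cases h1 : x ⊓ y = x
  · rw [h1]; exact hx
  by_cases h2 : x ⊓ y = y
  · rw [h2]; exact hy
  exact isBr_of_two (lt_of_le_of_ne inf_le_left h1) (lt_of_le_of_ne inf_le_right h2)
    (lt_irrefl _)

theorem val_nil : Val ([] : List (Lt m)) := by
  intro u l v h
  simp at h

theorem exists_gt_bot : ∃ x : W m, ⊥ < x := by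
  refine ⟨pt (w := []) (t := ⊤) val_nil (by simp), ?_⟩
  rw [lt_iff_exists bot_le]
  exact ⟨[], by simp [pt, P, bot_apply, bs]⟩

theorem order_nonBr {p : W m} (hb : ¬ IsBr p) : ptOrder (W m) p = 1 ∨ ptOrder (W m) p = 2 := by
  by_cases hmax : ∃ x, p < x
  · obtain ⟨x, hx⟩ := hmax
    obtain ⟨a, ha⟩ := (lt_iff_exists hx.le).1 hx
    rcases classify_aux hx.le a ha with rfl | ⟨w, h1, h2, h3⟩
    · left
      rw [TreeLike.count (⊥ : W m) (T := Unit) (fun _ => ())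
        (fun x y hx hy => by simpa using inf_bot hx hy) (fun _ => ⟨x, hx, rfl⟩)]
      simp
    · right
      have hp : p ≠ ⊥ := by
        rintro rfl
        rw [bot_apply] at h1
        exact lt_irrefl _ h1
      rw [TreeLike.count p (T := Unit) (fun _ => ())
        (fun x y hx hy => by
          simpa using inf_lt hx hy (nonbranch h1 h2 h3 hb hx) (nonbranch h1 h2 h3 hb hy))
        (fun _ => ⟨x, hx, rfl⟩)]
      simp [hp]
  · left
    have hp : p ≠ ⊥ := by
      rintro rfl
      exact hmax exists_gt_bot
    have he : {C : Set (W m) | ∃ x, p < x ∧ C = TreeLike.up p x} = ∅ := by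
      ext C
      simp only [mem_ofPred_eq, mem_empty_iff_false, iff_false]
      rintro ⟨x, hx, _⟩
      exact hmax ⟨x, hx⟩
    rw [ptOrder, TreeLike.setComponents_eq, he, if_neg hp, union_empty, ncard_singleton]

open Classical in
theorem order_Br {p : W m} (hb : IsBr p) : ptOrder (W m) p = m + 2 := by
  obtain ⟨w, d, h1, h2, h3⟩ := hb
  have hp : p ≠ ⊥ := by
    rintro rfl
    rw [bot_apply] at h2
    exact lt_irrefl _ h2
  have hpP := eq_P p h2.ne' h3
  have hVw : Val w := Val_of p h2.ne'
  have hlet : ∀ l : Lt m, vl l = p.1 w → ∃ i, l = (d, i) := by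
    rintro ⟨e, i⟩ h
    refine ⟨i, ?_⟩
    rw [h1] at h
    have h4 : (e : ℝ) = d := EReal.coe_injective h
    rw [Subtype.ext h4]
  have excl : ∀ x : W m, p < x → ∀ l, x.1 (w ++ [l]) ≠ 0 → x.1 w = vl l := fun x _ l h =>
    x.2.val w l h
  let dir : W m → Option (Fin m) := fun x =>
    if h : ∃ i, x.1 (w ++ [(d, i)]) ≠ 0 then some h.choose else none
  have dir_some : ∀ x : W m, ∀ i, x.1 (w ++ [(d, i)]) ≠ 0 → dir x = some i := by
    intro x i h
    have hh : ∃ i, x.1 (w ++ [(d, i)]) ≠ 0 := ⟨i, h⟩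
    have h5 := x.2.uniq w _ _ h hh.choose_spec
    simp only [dir, dif_pos hh]
    congr 1
    exact (congrArg Prod.snd h5).symm
  have dir_cases : ∀ x : W m, p < x → (p.1 w < x.1 w ∧ dir x = none) ∨
      (∃ i, x.1 (w ++ [(d, i)]) ≠ 0 ∧ dir x = some i ∧ x.1 w = p.1 w) := by
    intro x hx
    rcases dirs hx h2 h3 with h | ⟨l, h, h'⟩
    · left
      refine ⟨h, ?_⟩
      have : ¬ ∃ i, x.1 (w ++ [(d, i)]) ≠ 0 := by
        rintro ⟨i, hi⟩
        have := x.2.val w _ hi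
        rw [this, h1] at h
        exact lt_irrefl _ h
      simp only [dir, dif_neg this]
    · right
      obtain ⟨i, rfl⟩ := hlet l h
      exact ⟨i, h', dir_some x i h', by rw [x.2.val w _ h', h]⟩
  have cnt := TreeLike.count p dir ?_ ?_
  · rw [cnt, if_neg hp]
    simp
  · intro x y hx hy
    constructor
    · intro hxy
      rcases dir_cases _ hxy with ⟨h, _⟩ | ⟨i, h, _⟩
      · rw [inf_apply, lt_inf_iff] at h
        rcases dir_cases _ hx with ⟨_, h5⟩ | ⟨i, _, _, h6⟩
        · rcases dir_cases _ hy with ⟨_, h7⟩ | ⟨i, _, _, h6⟩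
          · rw [h5, h7]
          · exact absurd h6 h.2.ne'
        · exact absurd h6 h.1.ne'
      · have h0 : 0 < (x ⊓ y).1 (w ++ [(d, i)]) :=
          lt_of_le_of_ne ((x ⊓ y).2.nonneg _ (by simp)) (Ne.symm h)
        rw [inf_apply, lt_inf_iff] at h0
        rw [dir_some x i h0.1.ne', dir_some y i h0.2.ne']
    · intro hd
      rcases dir_cases _ hx with ⟨h, h5⟩ | ⟨i, h, h5, h6⟩
      · rcases dir_cases _ hy with ⟨h', h7⟩ | ⟨i, _, h7, h6⟩
        · exact inf_lt hx hy h h'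
        · rw [h5, h7] at hd
          simp at hd
      · rcases dir_cases _ hy with ⟨h', h7⟩ | ⟨j, h8, h7, h6⟩
        · rw [h5, h7] at hd
          simp at hd
        · rw [h5, h7] at hd
          simp only [Option.some.injEq] at hd
          subst hd
          refine inf_lt hx hy (w := w ++ [(d, i)]) ?_ ?_
          · rw [h3]
            exact lt_of_le_of_ne (x.2.nonneg _ (by simp)) (Ne.symm h)
          · rw [h3]
            exact lt_of_le_of_ne (y.2.nonneg _ (by simp)) (Ne.symm h8)
  · rintro (_ | i)
    · let x : W m := pt (w := w) (t := ⊤) hVw (fun _ => le_top)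
      have hxw : x.1 w = ⊤ := P_self _ _
      have hpw : p.1 w < ⊤ := by rw [h1]; exact EReal.coe_lt_top _
      have hle : p ≤ x := by
        intro v
        rw [hpP]
        exact P_le x (by rw [hxw]; exact (h2.trans hpw).ne') (by rw [hxw]; exact le_top) v
      have hlt : p < x := (lt_iff_exists hle).2 ⟨w, by rw [hxw]; exact hpw⟩
      refine ⟨x, hlt, ?_⟩
      rcases dir_cases _ hlt with ⟨_, h5⟩ | ⟨i, _, _, h6⟩
      · exact h5
      · rw [hxw] at h6
        exact absurd h6 hpw.ne'
    · have hV : Val (w ++ [((d, i) : Lt m)]) := Val_snoc hVw (by rw [h1] at h2; exact h2)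
      let x : W m := pt (w := w ++ [(d, i)]) (t := 1) hV (fun _ => zero_le_one)
      have hx1 : x.1 (w ++ [(d, i)]) = 1 := P_self _ _
      have hx2 : x.1 (w ++ [(d, i)]) ≠ 0 := by rw [hx1]; exact one_ne_zero
      have hxw : x.1 w = p.1 w := by rw [x.2.val w _ hx2, h1]; rfl
      have hle : p ≤ x := by
        intro v
        rw [hpP]
        exact P_le x (by rw [hxw]; exact h2.ne') (by rw [hxw]) v
      have hlt : p < x := (lt_iff_exists hle).2 ⟨w ++ [(d, i)], by rw [hx1, h3]; exact zero_lt_one⟩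
      exact ⟨x, hlt, dir_some x i hx2⟩

theorem order_iff (hm : 1 ≤ m) (p : W m) : ptOrder (W m) p = m + 2 ↔ IsBr p := by
  refine ⟨fun h => ?_, order_Br⟩
  by_contra hc
  rcases order_nonBr hc with h1 | h1 <;> omega

theorem isWaz (m : ℕ) : IsWazewskiDendrite (m + 2) (W m) := by
  haveI : CompactSpace (W m) := TreeLike.compact
  haveI : Countable (Lt m) := inferInstance
  haveI : Countable (List (Lt m)) := inferInstance
  haveI : SecondCountableTopology EReal := inferInstance
  haveI : SecondCountableTopology (List (Lt m) → EReal) := inferInstance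
  haveI : SecondCountableTopology (W m) := TopologicalSpace.Subtype.secondCountableTopology _
  refine ⟨⟨⟨⊥⟩, TreeLike.compact, TreeLike.connectedSpace, TreeLike.locallyConnected,
    TopologicalSpace.metrizableSpace_of_t3_secondCountable _, TreeLike.no_circle⟩, ?_, ?_⟩
  · intro p
    by_cases hp : IsBr p
    · exact Or.inr (Or.inr (order_Br hp))
    · rcases order_nonBr hp with h | h
      · exact Or.inl h
      · exact Or.inr (Or.inl h)
  · rintro A ⟨e⟩
    have hA : IsPreconnected A := by
      have h1 : IsPreconnected (range fun t => ((e.symm t : A) : W m)) :=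
        isPreconnected_range (continuous_subtype_val.comp e.symm.continuous)
      have h2 : range (fun t => ((e.symm t : A) : W m)) = A := by
        ext x
        constructor
        · rintro ⟨t, rfl⟩
          exact (e.symm t).2
        · intro hx
          exact ⟨e ⟨x, hx⟩, by simp⟩
      rwa [h2] at h1
    have hne : ((e.symm 0 : A) : W m) ≠ (e.symm 1 : A) := by
      intro h
      have := e.symm.injective (Subtype.ext h)
      exact zero_ne_one this
    rcases TreeLike.exists_sep hne with h | h
    · obtain ⟨b, hb, h1, h2⟩ := dense_Br _ _ h
      exact ⟨b, TreeLike.separation (fun hc => absurd (le_inf h2.le hc) (not_le_of_gt h1)) h2 hA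
        (e.symm 0).2 (e.symm 1).2, order_Br hb⟩
    · obtain ⟨b, hb, h1, h2⟩ := dense_Br _ _ h
      exact ⟨b, TreeLike.separation (fun hc => absurd (le_inf hc h2.le) (not_le_of_gt h1)) h2 hA
        (e.symm 1).2 (e.symm 0).2, order_Br hb⟩

end Waz

namespace Waz

variable {m : ℕ}

/-! The move of the root arm. -/

theorem Dy.add {a b : ℝ} (ha : a ∈ Dy) (hb : b ∈ Dy) : a + b ∈ Dy := by
  obtain ⟨p, k, rfl⟩ := ha
  obtain ⟨q, j, rfl⟩ := hb
  refine ⟨p * 2 ^ j + q * 2 ^ k, k + j, ?_⟩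
  push_cast
  field_simp
  ring

theorem Dy.neg {a : ℝ} (ha : a ∈ Dy) : -a ∈ Dy := by
  obtain ⟨p, k, rfl⟩ := ha
  refine ⟨-p, k, ?_⟩
  push_cast
  ring

theorem Dy.half {a : ℝ} (ha : a ∈ Dy) : a / 2 ∈ Dy := by
  obtain ⟨p, k, rfl⟩ := ha
  refine ⟨p, k + 1, ?_⟩
  rw [pow_succ]
  field_simp

theorem Dy.zero : (0 : ℝ) ∈ Dy := by simpa using dy_int 0
theorem Dy.one : (1 : ℝ) ∈ Dy := by simpa using dy_int 1

theorem Dy.max {a b : ℝ} (ha : a ∈ Dy) (hb : b ∈ Dy) : max a b ∈ Dy := by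
  rcases max_choice a b with h | h <;> rw [h] <;> assumption

theorem Dy.min {a b : ℝ} (ha : a ∈ Dy) (hb : b ∈ Dy) : min a b ∈ Dy := by
  rcases min_choice a b with h | h <;> rw [h] <;> assumption

theorem Dy.sub {a b : ℝ} (ha : a ∈ Dy) (hb : b ∈ Dy) : a - b ∈ Dy := by
  rw [sub_eq_add_neg]
  exact Dy.add ha (Dy.neg hb)

/-- A homeomorphism of the root arm preserving dyadics. -/
structure Mv where
  F : EReal ≃ₜ EReal
  σ : Dy ≃ Dy
  spec : ∀ d : Dy, F ((d : ℝ) : EReal) = ((σ d : ℝ) : EReal)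

namespace Mv

/-- Composition. -/
noncomputable def comp (M N : Mv) : Mv where
  F := N.F.trans M.F
  σ := N.σ.trans M.σ
  spec d := by
    simp only [Homeomorph.trans_apply, Equiv.trans_apply]
    rw [N.spec, M.spec]

/-- Inverse. -/
noncomputable def symm (M : Mv) : Mv where
  F := M.F.symm
  σ := M.σ.symm
  spec d := by
    rw [Homeomorph.symm_apply_eq, M.spec, Equiv.apply_symm_apply]

/-- Identity. -/
noncomputable def one : Mv where
  F := Homeomorph.refl _
  σ := Equiv.refl _
  spec _ := rfl

theorem symm_spec (M : Mv) (d : Dy) : M.F.symm ((d : ℝ) : EReal) = ((M.σ.symm d : ℝ) : EReal) :=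
  M.symm.spec d

/-- Raw action. -/
noncomputable def raw (M : Mv) (x : List (Lt m) → EReal) : List (Lt m) → EReal
  | [] => M.F (x [])
  | l :: w => x ((M.σ.symm l.1, l.2) :: w)

theorem good_raw (M : Mv) {x : List (Lt m) → EReal} (hx : Good x) : Good (M.raw x) := by
  refine ⟨?_, ?_, ?_, ?_⟩
  · intro w l h
    cases w with
    | nil =>
      have h1 : x [(M.σ.symm l.1, l.2)] ≠ 0 := h
      have h2 := hx.val [] _ h1
      change M.F (x []) = _
      rw [h2]
      have := M.spec (M.σ.symm l.1)
      rw [Equiv.apply_symm_apply] at this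
      exact this
    | cons a w => exact hx.val ((M.σ.symm a.1, a.2) :: w) l h
  · intro w l l' h h'
    cases w with
    | nil =>
      have := hx.uniq [] (M.σ.symm l.1, l.2) (M.σ.symm l'.1, l'.2) h h'
      rw [Prod.mk.injEq] at this
      exact Prod.ext (M.σ.symm.injective this.1) this.2
    | cons a w => exact hx.uniq ((M.σ.symm a.1, a.2) :: w) l l' h h'
  · intro w hw
    cases w with
    | nil => exact absurd rfl hw
    | cons a w => exact hx.nonneg ((M.σ.symm a.1, a.2) :: w) (by simp)
  · intro w l hw h
    cases w with
    | nil => exact absurd rfl hw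
    | cons a w => exact hx.pos ((M.σ.symm a.1, a.2) :: w) l (by simp) h

theorem raw_symm (M : Mv) (x : List (Lt m) → EReal) : M.symm.raw (M.raw x) = x := by
  funext w
  cases w with
  | nil => exact M.F.symm_apply_apply _
  | cons a w =>
    change x ((M.σ.symm (M.σ.symm.symm a.1), a.2) :: w) = _
    simp

theorem cont_raw (M : Mv) : Continuous (M.raw : (List (Lt m) → EReal) → _) := by
  refine continuous_pi fun w => ?_
  cases w with
  | nil => exact M.F.continuous.comp (continuous_apply [])
  | cons a w => exact continuous_apply _

/-- The induced homeomorphism. -/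
noncomputable def A (M : Mv) : W m ≃ₜ W m where
  toFun x := ⟨M.raw x.1, M.good_raw x.2⟩
  invFun x := ⟨M.symm.raw x.1, M.symm.good_raw x.2⟩
  left_inv x := Subtype.ext (M.raw_symm x.1)
  right_inv x := Subtype.ext (M.symm.raw_symm x.1)
  continuous_toFun := Continuous.subtype_mk (M.cont_raw.comp continuous_subtype_val) _
  continuous_invFun := Continuous.subtype_mk (M.symm.cont_raw.comp continuous_subtype_val) _

theorem A_nil (M : Mv) (x : W m) : (M.A x).1 [] = M.F (x.1 []) := rfl

theorem A_cons (M : Mv) (x : W m) (l : Lt m) (w) :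
    (M.A x).1 (l :: w) = x.1 ((M.σ.symm l.1, l.2) :: w) := rfl

theorem A_comp (M N : Mv) : ((M.comp N).A : W m ≃ₜ W m) = M.A * N.A := by
  apply Homeomorph.ext
  intro x
  apply Subtype.ext
  funext w
  cases w <;> rfl

theorem A_symm (M : Mv) : (M.symm.A : W m ≃ₜ W m) = M.A⁻¹ := by
  apply Homeomorph.ext
  intro x
  rfl

theorem A_one : (one.A : W m ≃ₜ W m) = 1 := by
  apply Homeomorph.ext
  intro x
  apply Subtype.ext
  funext w
  cases w <;> rfl

theorem A_fix (M : Mv) (x : W m) (h : M.F (x.1 []) = x.1 []) : M.A x = x := by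
  apply Subtype.ext
  funext w
  cases w with
  | nil => exact h
  | cons l w =>
    rw [A_cons]
    by_cases hl : x.1 [] = vl l
    · have h1 : M.σ l.1 = l.1 := by
        rw [hl] at h
        have := M.spec l.1
        rw [vl] at h
        rw [h] at this
        exact (Subtype.ext (EReal.coe_injective this)).symm
      have h2 : M.σ.symm l.1 = l.1 := by
        rw [Equiv.symm_apply_eq, h1]
      rw [h2]
    · have h1 : x.1 (l :: w) = 0 := by
        by_contra hc
        exact hl (val_of_ext x (w := []) hc)
      rw [h1]
      by_contra hc
      have h2 := val_of_ext x (w := []) hc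
      apply hl
      rw [← h, h2, vl, M.spec, Equiv.apply_symm_apply, vl]

end Mv

/-- Branch point on a given arm. -/
def Br (w : List (Lt m)) (x : W m) : Prop := ∃ d : Dy, x.1 w = ((d : ℝ) : EReal) ∧
  bs w < x.1 w ∧ ∀ l, x.1 (w ++ [l]) = 0

theorem isBr_iff (x : W m) : IsBr x ↔ ∃ w, Br w x := Iff.rfl

theorem Br.A_nil {x : W m} (h : Br [] x) (M : Mv) : Br [] (M.A x) := by
  obtain ⟨d, h1, h2, h3⟩ := h
  have h4 : (M.A x).1 [] = ((M.σ d : ℝ) : EReal) := by rw [M.A_nil, h1, M.spec]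
  refine ⟨M.σ d, h4, ?_, fun l => ?_⟩
  · rw [h4]; exact EReal.bot_lt_coe _
  · exact h3 _

theorem Br.A_cons {x : W m} {l : Lt m} {w} (h : Br (l :: w) x) (M : Mv) :
    Br ((M.σ l.1, l.2) :: w) (M.A x) := by
  obtain ⟨d, h1, h2, h3⟩ := h
  have h4 : ∀ v, (M.A x).1 ((M.σ l.1, l.2) :: v) = x.1 (l :: v) := by
    intro v
    rw [M.A_cons]
    simp
  refine ⟨d, by rw [h4, h1], ?_, fun kk => ?_⟩
  · rw [h4]; exact h2
  · have := h4 (w ++ [kk])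
    rw [List.cons_append, this]
    exact h3 kk


/-- Homeomorphism of `EReal` from an order isomorphism of the reals. -/
noncomputable def ext (e : ℝ ≃o ℝ) : EReal ≃o EReal := e.withTopCongr.withBotCongr

theorem ext_coe (e : ℝ ≃o ℝ) (x : ℝ) : ext e (x : EReal) = ((e x : ℝ) : EReal) := rfl

/-- Move from a real order isomorphism. -/
noncomputable def mk (e : ℝ ≃o ℝ) (h1 : ∀ d ∈ Dy, e d ∈ Dy) (h2 : ∀ d ∈ Dy, e.symm d ∈ Dy) :
    Mv where
  F := (ext e).toHomeomorph
  σ :=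
    { toFun := fun d => ⟨e d, h1 d d.2⟩
      invFun := fun d => ⟨e.symm d, h2 d d.2⟩
      left_inv := fun d => Subtype.ext (e.symm_apply_apply _)
      right_inv := fun d => Subtype.ext (e.apply_symm_apply _) }
  spec _ := rfl

/-- Translation. -/
noncomputable def tm : Mv := mk (OrderIso.addRight 1) (fun d hd => Dy.add hd Dy.one)
  (fun d hd => Dy.sub hd Dy.one)

/-- Doubling on the positive side. -/
noncomputable def fe : ℝ ≃o ℝ := StrictMono.orderIsoOfRightInverse (fun x => x + max x 0)
  (fun x y h => by
    have := max_le_max_right 0 h.le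
    simp only
    linarith)
  (fun y => min y (y / 2))
  (fun y => by
    simp only
    rcases le_total 0 y with h | h
    · rw [min_eq_right (by linarith), max_eq_left (by linarith)]
      ring
    · rw [min_eq_left (by linarith), max_eq_right (by linarith)]
      ring)

/-- Stretching of the unit interval. -/
noncomputable def ue : ℝ ≃o ℝ := StrictMono.orderIsoOfRightInverse (fun x => x + max 0 (min x 1))
  (fun x y h => by
    have := max_le_max_left 0 (min_le_min_right 1 h.le)
    simp only
    linarith)
  (fun y => y - max 0 (min (y / 2) 1))
  (fun y => by
    simp only
    rcases le_total 0 y with h | h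
    · rcases le_total y 2 with h' | h'
      · have h1 : max 0 (min (y / 2) 1) = y / 2 := by
          rw [min_eq_left (by linarith), max_eq_right (by linarith)]
        rw [h1, min_eq_left (by linarith), max_eq_right (by linarith)]
        ring
      · have h1 : max 0 (min (y / 2) 1) = 1 := by
          rw [min_eq_right (by linarith), max_eq_right (by linarith)]
        rw [h1, min_eq_right (by linarith), max_eq_right (by linarith)]
        ring
    · have h1 : max 0 (min (y / 2) 1) = 0 := by
        rw [min_eq_left (by linarith), max_eq_left (by linarith)]
      rw [h1, min_eq_left (by linarith), max_eq_left (by linarith)]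
      ring)

theorem fe_apply (x : ℝ) : fe x = x + max x 0 := rfl
theorem ue_apply (x : ℝ) : ue x = x + max 0 (min x 1) := rfl

/-- The move `f`. -/
noncomputable def fm : Mv := mk fe (fun d hd => Dy.add hd (Dy.max hd Dy.zero))
  (fun d hd => Dy.min hd (Dy.half hd))

/-- The move `u`. -/
noncomputable def um : Mv := mk ue (fun d hd => Dy.add hd (Dy.max Dy.zero (Dy.min hd Dy.one)))
  (fun d hd => Dy.sub hd (Dy.max Dy.zero (Dy.min (Dy.half hd) Dy.one)))

/-- The reflection. -/
noncomputable def rm : Mv where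
  F := Homeomorph.neg EReal
  σ :=
    { toFun := fun d => ⟨-d, Dy.neg d.2⟩
      invFun := fun d => ⟨-d, Dy.neg d.2⟩
      left_inv := fun d => Subtype.ext (neg_neg _)
      right_inv := fun d => Subtype.ext (neg_neg _) }
  spec _ := rfl

/-- Fixing the nonpositive part. -/
def Mv.Fx (M : Mv) : Prop := ∀ t : EReal, t ≤ 0 → M.F t = t

theorem Mv.Fx.comp {M N : Mv} (hM : M.Fx) (hN : N.Fx) : (M.comp N).Fx := by
  intro t ht
  change M.F (N.F t) = t
  rw [hN t ht, hM t ht]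

theorem Mv.Fx.symm {M : Mv} (hM : M.Fx) : M.symm.Fx := by
  intro t ht
  change M.F.symm t = t
  rw [Homeomorph.symm_apply_eq, hM t ht]

theorem fx_mk (e : ℝ ≃o ℝ) (h1 h2) (h : ∀ x ≤ 0, e x = x) : (mk e h1 h2).Fx := by
  intro t ht
  induction t with
  | bot => exact map_bot (ext e)
  | coe x =>
    change ext e x = _
    rw [ext_coe, h x (by exact_mod_cast ht)]
  | top => simp at ht

theorem fx_fm : fm.Fx := fx_mk _ _ _ (fun x hx => by rw [fe_apply, max_eq_right hx, add_zero])

theorem fx_um : um.Fx := fx_mk _ _ _ (fun x hx => by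
  rw [ue_apply, min_eq_left (by linarith), max_eq_left hx, add_zero])

theorem fm_coe (x : ℝ) (h : 0 ≤ x) : fm.F (x : EReal) = ((2 * x : ℝ) : EReal) := by
  change ext fe x = _
  rw [ext_coe, fe_apply, max_eq_left h, two_mul]

theorem um_coe (x : ℝ) (h : 1 ≤ x) : um.F (x : EReal) = ((x + 1 : ℝ) : EReal) := by
  change ext ue x = _
  rw [ext_coe, ue_apply, min_eq_right h, max_eq_right zero_le_one]

theorem tm_coe (x : ℝ) : tm.F (x : EReal) = ((x + 1 : ℝ) : EReal) := rfl

theorem move_int (G : Subgroup (W m ≃ₜ W m)) (hf : fm.A ∈ G) (hu : um.A ∈ G)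
    (k : ℕ) : ∃ M : Mv, M.A ∈ G ∧ M.Fx ∧ M.F (((k + 1 : ℕ) : ℝ) : EReal) = 1 := by
  induction k with
  | zero => exact ⟨Mv.one, by rw [Mv.A_one]; exact G.one_mem, fun t _ => rfl, by simp [Mv.one]⟩
  | succ k ih =>
    obtain ⟨M, h1, h2, h3⟩ := ih
    refine ⟨M.comp um.symm, by rw [Mv.A_comp, Mv.A_symm]; exact G.mul_mem h1 (G.inv_mem hu),
      h2.comp fx_um.symm, ?_⟩
    change M.F (um.F.symm _) = 1
    rw [← h3]
    congr 1
    rw [Homeomorph.symm_apply_eq, um_coe]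
    · push_cast; rfl
    · simp

theorem move_dy (G : Subgroup (W m ≃ₜ W m)) (hf : fm.A ∈ G) (hu : um.A ∈ G)
    (k : ℕ) (p : ℤ) (hp : 0 < p) :
    ∃ M : Mv, M.A ∈ G ∧ M.Fx ∧ M.F (((p / 2 ^ k : ℝ)) : EReal) = 1 := by
  induction k with
  | zero =>
    obtain ⟨j, hj⟩ : ∃ j : ℕ, p = (j + 1 : ℕ) := ⟨(p - 1).toNat, by omega⟩
    obtain ⟨M, h1, h2, h3⟩ := move_int G hf hu j
    refine ⟨M, h1, h2, ?_⟩
    rw [← h3, hj]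
    simp
  | succ k ih =>
    obtain ⟨M, h1, h2, h3⟩ := ih
    refine ⟨M.comp fm, by rw [Mv.A_comp]; exact G.mul_mem h1 hf, h2.comp fx_fm, ?_⟩
    change M.F (fm.F _) = 1
    rw [← h3, fm_coe]
    · congr 2
      rw [pow_succ]
      field_simp
    · positivity

theorem move (G : Subgroup (W m ≃ₜ W m)) (hf : fm.A ∈ G) (hu : um.A ∈ G)
    (d : Dy) (hd : 0 < (d : ℝ)) :
    ∃ M : Mv, M.A ∈ G ∧ M.Fx ∧ M.F ((d : ℝ) : EReal) = 1 := by
  obtain ⟨p, k, h⟩ := d.2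
  have hp : 0 < p := by
    rw [h] at hd
    have : (0 : ℝ) < p := by
      by_contra hc
      push Not at hc
      exact absurd hd (not_lt_of_ge (div_nonpos_of_nonpos_of_nonneg hc (by positivity)))
    exact_mod_cast this
  rw [h]
  exact move_dy G hf hu k p hp

end Waz

namespace Waz

variable {m : ℕ}

/-- The letter at zero. -/
def zl (i : Fin m) : Lt m := (⟨0, Dy.zero⟩, i)

theorem vl_zl (i : Fin m) : vl (zl i) = 0 := by simp [vl, zl]

open Classical in
/-- Reindexing. -/
noncomputable def tau (i : Fin m) : List (Lt m) → List (Lt m)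
  | [] => []
  | l :: v => if l = zl i then (match v with
      | [] => [zl i]
      | l' :: w => if 0 < vl l' then l' :: w else l :: l' :: w)
    else if 0 < vl l then zl i :: l :: v else l :: v

theorem ne_zl {i : Fin m} {l : Lt m} (h : 0 < vl l) : l ≠ zl i := by
  rintro rfl
  rw [vl_zl] at h
  exact lt_irrefl _ h

theorem tau_z_pos (i : Fin m) {l : Lt m} (h : 0 < vl l) (w) :
    tau i (zl i :: l :: w) = l :: w := by simp [tau, h]

theorem tau_z_neg (i : Fin m) {l : Lt m} (h : ¬ 0 < vl l) (w) :
    tau i (zl i :: l :: w) = zl i :: l :: w := by simp [tau, h]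

theorem tau_pos (i : Fin m) {l : Lt m} (h : 0 < vl l) (w) :
    tau i (l :: w) = zl i :: l :: w := by simp [tau, h, ne_zl h]

theorem tau_neg (i : Fin m) {l : Lt m} (hl : l ≠ zl i) (h : ¬ 0 < vl l) (w) :
    tau i (l :: w) = l :: w := by simp [tau, h, hl]

/-- Words which are properly reindexed. -/
def Gen (i : Fin m) (w : List (Lt m)) : Prop := w ≠ [] ∧ w ≠ [zl i]

theorem gen_cases (i : Fin m) {w : List (Lt m)} (h : Gen i w) :
    (∃ l v, w = zl i :: l :: v ∧ 0 < vl l) ∨ (∃ l v, w = zl i :: l :: v ∧ ¬ 0 < vl l) ∨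
    (∃ l v, w = l :: v ∧ 0 < vl l) ∨ (∃ l v, w = l :: v ∧ l ≠ zl i ∧ ¬ 0 < vl l) := by
  obtain ⟨h1, h2⟩ := h
  cases w with
  | nil => exact absurd rfl h1
  | cons l v =>
    by_cases hl : l = zl i
    · subst hl
      cases v with
      | nil => exact absurd rfl h2
      | cons a v =>
        by_cases ha : 0 < vl a
        · exact Or.inl ⟨a, v, rfl, ha⟩
        · exact Or.inr (Or.inl ⟨a, v, rfl, ha⟩)
    · by_cases h : 0 < vl l
      · exact Or.inr (Or.inr (Or.inl ⟨l, v, rfl, h⟩))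
      · exact Or.inr (Or.inr (Or.inr ⟨l, v, rfl, hl, h⟩))

theorem gen_tau {i : Fin m} {w : List (Lt m)} (h : Gen i w) : Gen i (tau i w) := by
  rcases gen_cases i h with ⟨l, v, rfl, hl⟩ | ⟨l, v, rfl, hl⟩ | ⟨l, v, rfl, hl⟩ | ⟨l, v, rfl, hz, hl⟩
  · rw [tau_z_pos i hl]
    exact ⟨by simp, by simp [ne_zl hl]⟩
  · rw [tau_z_neg i hl]
    exact ⟨by simp, by simp⟩
  · rw [tau_pos i hl]
    exact ⟨by simp, by simp⟩
  · rw [tau_neg i hz hl]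
    exact ⟨by simp, by simp [hz]⟩

theorem tau_tau {i : Fin m} {w : List (Lt m)} (h : Gen i w) : tau i (tau i w) = w := by
  rcases gen_cases i h with ⟨l, v, rfl, hl⟩ | ⟨l, v, rfl, hl⟩ | ⟨l, v, rfl, hl⟩ | ⟨l, v, rfl, hz, hl⟩
  · rw [tau_z_pos i hl, tau_pos i hl]
  · rw [tau_z_neg i hl, tau_z_neg i hl]
  · rw [tau_pos i hl, tau_z_pos i hl]
  · rw [tau_neg i hz hl, tau_neg i hz hl]

theorem tau_append {i : Fin m} {w : List (Lt m)} (h : Gen i w) (u : List (Lt m)) :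
    tau i (w ++ u) = tau i w ++ u := by
  rcases gen_cases i h with ⟨l, v, rfl, hl⟩ | ⟨l, v, rfl, hl⟩ | ⟨l, v, rfl, hl⟩ | ⟨l, v, rfl, hz, hl⟩
  · rw [tau_z_pos i hl, List.cons_append, List.cons_append, tau_z_pos i hl]
  · rw [tau_z_neg i hl, List.cons_append, List.cons_append, tau_z_neg i hl]
  · rw [tau_pos i hl, List.cons_append, tau_pos i hl, List.cons_append, List.cons_append]
  · rw [tau_neg i hz hl, List.cons_append, tau_neg i hz hl]

theorem gen_append {i : Fin m} {w : List (Lt m)} (h : Gen i w) (u : List (Lt m)) :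
    Gen i (w ++ u) := by
  rcases gen_cases i h with ⟨l, v, rfl, hl⟩ | ⟨l, v, rfl, hl⟩ | ⟨l, v, rfl, hl⟩ | ⟨l, v, rfl, hz, hl⟩
  · exact ⟨by simp, by simp⟩
  · exact ⟨by simp, by simp⟩
  · exact ⟨by simp, by simp [ne_zl hl]⟩
  · exact ⟨by simp, by simp [hz]⟩

open Classical in
/-- Raw swap. -/
noncomputable def craw (i : Fin m) (x : List (Lt m) → EReal) (w : List (Lt m)) : EReal :=
  if w = [] then min (x []) 0 + x [zl i]
  else if w = [zl i] then max (x []) 0 else x (tau i w)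

theorem craw_nil (i : Fin m) (x : List (Lt m) → EReal) :
    craw i x [] = min (x []) 0 + x [zl i] := by simp [craw]

theorem craw_z (i : Fin m) (x : List (Lt m) → EReal) : craw i x [zl i] = max (x []) 0 := by
  simp [craw]

theorem craw_gen {i : Fin m} (x : List (Lt m) → EReal) {w : List (Lt m)} (h : Gen i w) :
    craw i x w = x (tau i w) := by
  simp [craw, h.1, h.2]

theorem word_cases (i : Fin m) (w : List (Lt m)) : w = [] ∨ w = [zl i] ∨ Gen i w := by
  by_cases h1 : w = []
  · exact Or.inl h1
  · by_cases h2 : w = [zl i]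
    · exact Or.inr (Or.inl h2)
    · exact Or.inr (Or.inr ⟨h1, h2⟩)

theorem nil_of_z {i : Fin m} (x : W m) (h : x.1 [zl i] ≠ 0) : x.1 [] = 0 := by
  rw [x.2.val [] _ h, vl_zl]

theorem z_zero {i : Fin m} (x : W m) (h : x.1 [] ≠ 0) : x.1 [zl i] = 0 := by
  by_contra hc
  exact h (nil_of_z x hc)

/-- First-letter analysis of nonvanishing coordinates. -/
theorem craw_letter {i : Fin m} (x : W m) {l : Lt m} (h : craw i x.1 [l] ≠ 0) :
    (l = zl i ∧ 0 < x.1 []) ∨ (0 < vl l ∧ x.1 [zl i, l] ≠ 0 ∧ x.1 [zl i] = vl l ∧ x.1 [] = 0) ∨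
    (l ≠ zl i ∧ ¬ 0 < vl l ∧ x.1 [l] ≠ 0 ∧ x.1 [] = vl l ∧ x.1 [zl i] = 0) := by
  by_cases hl : l = zl i
  · left
    refine ⟨hl, ?_⟩
    rw [hl, craw_z] at h
    by_contra hc
    push Not at hc
    exact h (max_eq_right hc)
  · rw [craw_gen _ ⟨by simp, by simpa using hl⟩] at h
    right
    by_cases hp : 0 < vl l
    · left
      rw [tau_pos i hp] at h
      have h1 : x.1 [zl i] = vl l := x.2.val [zl i] l h
      exact ⟨hp, h, h1, nil_of_z x (by rw [h1]; exact hp.ne')⟩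
    · right
      rw [tau_neg i hl hp] at h
      refine ⟨hl, hp, h, x.2.val [] l h, ?_⟩
      by_contra hc
      exact hl (x.2.uniq [] _ _ h hc)

theorem craw_z_letter {i : Fin m} (x : W m) {l : Lt m} (h : craw i x.1 ([zl i] ++ [l]) ≠ 0) :
    0 < vl l ∧ x.1 [l] ≠ 0 := by
  rw [craw_gen _ ⟨by simp, by simp⟩] at h
  change x.1 (tau i (zl i :: l :: [])) ≠ 0 at h
  by_cases hp : 0 < vl l
  · rw [tau_z_pos i hp] at h
    exact ⟨hp, h⟩
  · rw [tau_z_neg i hp] at h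
    exact absurd (x.2.pos [zl i] l (by simp) h) hp

theorem good_craw (i : Fin m) (x : W m) : Good (craw i x.1) := by
  refine ⟨?_, ?_, ?_, ?_⟩
  · intro w l h
    rcases word_cases i w with rfl | rfl | hw
    · rw [List.nil_append] at h
      rw [craw_nil]
      rcases craw_letter x h with ⟨rfl, h1⟩ | ⟨h1, h2, h3, h4⟩ | ⟨h1, h2, h3, h4, h5⟩
      · rw [z_zero x h1.ne', min_eq_right h1.le, vl_zl, add_zero]
      · rw [h4, h3, min_self, zero_add]
      · rw [h5, h4, add_zero, min_eq_left (not_lt.1 h2)]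
    · obtain ⟨h1, h2⟩ := craw_z_letter x h
      rw [craw_z, x.2.val [] l h2, max_eq_left h1.le]
    · rw [craw_gen _ (gen_append hw _), tau_append hw] at h
      rw [craw_gen _ hw]
      exact x.2.val _ _ h
  · intro w l l' h h'
    rcases word_cases i w with rfl | rfl | hw
    · rw [List.nil_append] at h h'
      rcases craw_letter x h with ⟨h1, h2⟩ | ⟨h1, h2, h3, h4⟩ | ⟨h1, h2, h3, h4, h5⟩
      · rcases craw_letter x h' with ⟨k1, k2⟩ | ⟨k1, k2, k3, k4⟩ | ⟨k1, k2, k3, k4, k5⟩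
        · rw [h1, k1]
        · exact absurd k4 h2.ne'
        · rw [k4] at h2
          exact absurd h2 k2
      · rcases craw_letter x h' with ⟨k1, k2⟩ | ⟨k1, k2, k3, k4⟩ | ⟨k1, k2, k3, k4, k5⟩
        · exact absurd h4 k2.ne'
        · exact x.2.uniq [zl i] _ _ h2 k2
        · rw [h3] at k5
          exact absurd k5 h1.ne'
      · rcases craw_letter x h' with ⟨k1, k2⟩ | ⟨k1, k2, k3, k4⟩ | ⟨k1, k2, k3, k4, k5⟩
        · rw [h4] at k2
          exact absurd k2 h2
        · rw [k3] at h5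
          exact absurd h5 k1.ne'
        · exact x.2.uniq [] _ _ h3 k3
    · exact x.2.uniq [] _ _ (craw_z_letter x h).2 (craw_z_letter x h').2
    · rw [craw_gen _ (gen_append hw _), tau_append hw] at h h'
      exact x.2.uniq _ _ _ h h'
  · intro w hw
    rcases word_cases i w with rfl | rfl | hw
    · exact absurd rfl hw
    · rw [craw_z]; exact le_max_right _ _
    · rw [craw_gen _ hw]
      exact x.2.nonneg _ (gen_tau hw).1
  · intro w l hw h
    rcases word_cases i w with rfl | rfl | hw
    · exact absurd rfl hw
    · exact (craw_z_letter x h).1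
    · rw [craw_gen _ (gen_append hw _), tau_append hw] at h
      exact x.2.pos _ _ (gen_tau hw).1 h

theorem craw_craw (i : Fin m) (x : W m) : craw i (craw i x.1) = x.1 := by
  funext w
  rcases word_cases i w with rfl | rfl | hw
  · rw [craw_nil, craw_nil, craw_z]
    rcases lt_trichotomy (x.1 []) 0 with h | h | h
    · rw [z_zero x h.ne, min_eq_left h.le, max_eq_right h.le, add_zero, add_zero, min_eq_left h.le]
    · rw [h, min_self, zero_add, max_self, add_zero, min_eq_right (x.2.nonneg _ (by simp))]
    · rw [z_zero x h.ne', min_eq_right h.le, max_eq_left h.le, add_zero, min_self, zero_add]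
  · rw [craw_z, craw_nil]
    rcases lt_trichotomy (x.1 []) 0 with h | h | h
    · rw [z_zero x h.ne, min_eq_left h.le, add_zero, max_eq_right h.le]
    · rw [h, min_self, zero_add, max_eq_left (x.2.nonneg _ (by simp))]
    · rw [z_zero x h.ne', min_eq_right h.le, add_zero, max_self]
  · rw [craw_gen _ hw, craw_gen _ (gen_tau hw), tau_tau hw]

theorem cont_craw (i : Fin m) : Continuous fun x : W m => craw i x.1 := by
  have hc : ∀ w, Continuous fun x : W m => x.1 w := fun w =>
    (continuous_apply w).comp continuous_subtype_val
  refine continuous_pi fun w => ?_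
  rcases word_cases i w with rfl | rfl | hw
  · simp only [craw_nil]
    rw [continuous_iff_continuousAt]
    intro x
    have h1 : ContinuousAt (fun x : W m => (min (x.1 []) 0, x.1 [zl i])) x :=
      (((hc []).min continuous_const).prodMk (hc [zl i])).continuousAt
    have h2 : ContinuousAt (fun p : EReal × EReal => p.1 + p.2) (min (x.1 []) 0, x.1 [zl i]) := by
      apply EReal.continuousAt_add
      · left
        exact ne_top_of_le_ne_top EReal.zero_ne_top (min_le_right _ _)
      · by_cases h : x.1 [zl i] = 0
        · right
          simp [h]
        · left
          simp [nil_of_z x h]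
    exact ContinuousAt.comp (f := fun x : W m => (min (x.1 []) 0, x.1 [zl i])) h2 h1
  · simp only [craw_z]
    exact (hc []).max continuous_const
  · simp only [craw_gen _ hw]
    exact hc _

/-- The swap homeomorphism. -/
noncomputable def C (i : Fin m) : W m ≃ₜ W m where
  toFun x := ⟨craw i x.1, good_craw i x⟩
  invFun x := ⟨craw i x.1, good_craw i x⟩
  left_inv x := Subtype.ext (craw_craw i x)
  right_inv x := Subtype.ext (craw_craw i x)
  continuous_toFun := Continuous.subtype_mk (cont_craw i) _
  continuous_invFun := Continuous.subtype_mk (cont_craw i) _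

theorem C_apply (i : Fin m) (x : W m) (w) : (C i x).1 w = craw i x.1 w := rfl

theorem C_fix {i : Fin m} (x : W m) (h : x.1 [] ≤ 0) (hz : x.1 [zl i] = 0) : C i x = x := by
  have hp : ∀ l v, 0 < vl l → x.1 (l :: v) = 0 := by
    intro l v hl
    by_contra hc
    have := val_of_ext x (w := []) hc
    rw [this] at h
    exact absurd hl (not_lt_of_ge h)
  have hz' : ∀ v, x.1 (zl i :: v) = 0 := by
    intro v
    by_contra hc
    exact ne_of_ext x [] _ _ hc hz
  apply Subtype.ext
  funext w
  rw [C_apply]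
  rcases word_cases i w with rfl | rfl | hw
  · rw [craw_nil, hz, add_zero, min_eq_left h]
  · rw [craw_z, hz, max_eq_right h]
  · rw [craw_gen _ hw]
    rcases gen_cases i hw with ⟨l, v, rfl, hl⟩ | ⟨l, v, rfl, hl⟩ | ⟨l, v, rfl, hl⟩ |
      ⟨l, v, rfl, hz, hl⟩
    · rw [tau_z_pos i hl, hp _ _ hl, hz']
    · rw [tau_z_neg i hl]
    · rw [tau_pos i hl, hp _ _ hl, hz']
    · rw [tau_neg i hz hl]

theorem C_nil_pos {i : Fin m} {x : W m} (h : x.1 [zl i] ≠ 0) : 0 < (C i x).1 [] := by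
  rw [C_apply, craw_nil, nil_of_z x h, min_self, zero_add]
  exact lt_of_le_of_ne (x.2.nonneg _ (by simp)) (Ne.symm h)

theorem Br.C {i : Fin m} {x : W m} {w} (h : Br (zl i :: w) x) :
    Br w (C i x) ∧ 0 < (C i x).1 [] := by
  obtain ⟨d, h1, h2, h3⟩ := h
  have h2' : 0 < x.1 (zl i :: w) := h2
  have hz : x.1 [zl i] ≠ 0 := ne_of_ext x [] _ _ h2'.ne'
  have hx0 := nil_of_z x hz
  refine ⟨?_, C_nil_pos hz⟩
  cases w with
  | nil =>
    have h4 : (Waz.C i x).1 [] = x.1 [zl i] := by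
      rw [C_apply, craw_nil, hx0, min_self, zero_add]
    refine ⟨d, by rw [h4, h1], ?_, fun l => ?_⟩
    · rw [h4]
      exact lt_of_le_of_lt bot_le h2'
    · by_contra hc
      rcases craw_letter x hc with ⟨k1, k2⟩ | ⟨k1, k2, k3, k4⟩ | ⟨k1, k2, k3, k4, k5⟩
      · exact absurd hx0 k2.ne'
      · exact k2 (h3 l)
      · exact hz k5
  | cons a w =>
    have ha : 0 < vl a := x.2.pos [zl i] a (by simp) (ne_of_ext x [zl i] a w h2'.ne')
    have h4 : ∀ v, (Waz.C i x).1 (a :: v) = x.1 (zl i :: a :: v) := by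
      intro v
      rw [C_apply, craw_gen _ ⟨by simp, by simp [ne_zl ha]⟩, tau_pos i ha]
    refine ⟨d, by rw [h4, h1], ?_, fun l => ?_⟩
    · rw [h4]
      exact h2'
    · rw [List.cons_append, h4]
      exact h3 l

/-! The group. -/

/-- Generators. -/
noncomputable def gens (m : ℕ) : Set (W m ≃ₜ W m) := {tm.A, rm.A, fm.A, um.A} ∪ range C

/-- The group. -/
noncomputable def GG (m : ℕ) : Subgroup (W m ≃ₜ W m) := Subgroup.closure (gens m)

theorem GG_fg (m : ℕ) : (GG m).FG := by
  rw [Subgroup.fg_iff]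
  exact ⟨gens m, rfl, (toFinite _).union (finite_range _)⟩

theorem tm_mem : tm.A ∈ GG m := Subgroup.subset_closure (by simp [gens])
theorem rm_mem : rm.A ∈ GG m := Subgroup.subset_closure (by simp [gens])
theorem fm_mem : fm.A ∈ GG m := Subgroup.subset_closure (by simp [gens])
theorem um_mem : um.A ∈ GG m := Subgroup.subset_closure (by simp [gens])
theorem C_mem (i : Fin m) : C i ∈ GG m := Subgroup.subset_closure (by simp [gens])

/-- The points `0` and `1` on the root arm. -/
noncomputable def pp (t : EReal) : W m := pt (w := []) (t := t) val_nil (by simp)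

theorem pp_nil (t : EReal) : (pp t : W m).1 [] = t := P_self _ _
theorem pp_letter (t : EReal) (l : Lt m) : (pp t : W m).1 [l] = 0 := P_ext _ _ _

theorem eq_pp {x : W m} (h1 : x.1 [] ≠ ⊥) (h2 : ∀ l, x.1 [l] = 0) : x = pp (x.1 []) :=
  Subtype.ext (eq_P x h1 h2)

theorem pp_le {x : W m} {t : EReal} (h : x.1 [] ≠ ⊥) (h1 : t ≤ x.1 []) : pp t ≤ x := 
  fun v => P_le x h h1 v

theorem p0_le {x : W m} : pp 0 ≤ x ↔ 0 ≤ x.1 [] := by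
  constructor
  · intro h
    have := h []
    rwa [pp_nil] at this
  · intro h
    exact pp_le (fun hc => by rw [hc] at h; simp at h) h

theorem p0_lt_p1 : (pp 0 : W m) < pp 1 := by
  refine lt_of_le_of_ne (p0_le.2 (by rw [pp_nil]; exact zero_le_one)) (fun h => ?_)
  have := congrArg (fun z : W m => z.1 []) h
  simp only [pp_nil] at this
  exact zero_ne_one this

theorem mem_pos {z : W m} : z ∈ TreeLike.comp (pp 0 : W m) (pp 1) ↔ 0 < z.1 [] := by
  rw [TreeLike.comp, TreeLike.comp_up p0_lt_p1]
  change pp 0 < z ⊓ pp 1 ↔ _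
  constructor
  · intro h
    rcases dirs (w := []) h (by rw [pp_nil]; exact EReal.bot_lt_zero) (fun l => pp_letter _ _) with
      h1 | ⟨l, _, h1⟩
    · rw [pp_nil, inf_apply] at h1
      exact h1.trans_le inf_le_left
    · exfalso
      apply h1
      rw [inf_apply]
      change z.1 [l] ⊓ (pp 1 : W m).1 [l] = 0
      rw [pp_letter, inf_eq_right.2 (z.2.nonneg _ (by simp))]
  · intro h
    refine (lt_iff_exists (le_inf (p0_le.2 h.le) p0_lt_p1.le)).2 ⟨[], ?_⟩
    rw [inf_apply, pp_nil, pp_nil]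
    exact lt_inf_iff.2 ⟨h, zero_lt_one⟩

theorem coe_one' (x : ℝ) (h : (x : EReal) = 1) : x = 1 := by exact_mod_cast h

/-- Fixing pointwise the nonpositive part. -/
def Fixes (g : W m ≃ₜ W m) : Prop := ∀ z : W m, z.1 [] ≤ 0 → g z = z

theorem fixes_A {M : Mv} (h : M.Fx) : Fixes (M.A : W m ≃ₜ W m) := fun z hz =>
  M.A_fix z (h _ hz)

theorem tm_symm_neg {t : EReal} (h : t ≤ 0) : tm.F.symm t < 0 := by
  induction t with
  | bot =>
    have : tm.F.symm ⊥ = ⊥ := by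
      rw [Homeomorph.symm_apply_eq]
      exact (map_bot (ext _)).symm
    rw [this]
    exact EReal.bot_lt_zero
  | coe x =>
    have hx : x ≤ 0 := by exact_mod_cast h
    have : tm.F.symm (x : EReal) = ((x - 1 : ℝ) : EReal) := by
      rw [Homeomorph.symm_apply_eq, tm_coe]
      simp
    rw [this]
    have : x - 1 < 0 := by linarith
    exact_mod_cast this
  | top => simp at h

theorem fixes_D (i : Fin m) : Fixes (tm.A * C i * tm.A⁻¹ : W m ≃ₜ W m) := by
  intro z hz
  have h1 : (tm.A⁻¹ z : W m).1 [] < 0 := tm_symm_neg hz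
  have h2 : C i (tm.A⁻¹ z) = tm.A⁻¹ z := C_fix _ h1.le (z_zero _ h1.ne)
  change tm.A (C i (tm.A⁻¹ z)) = z
  rw [h2, TreeLike.app_inv]

theorem tm_pos {t : EReal} (h : 0 < t) : 0 < tm.F t := by
  have h1 : tm.F 0 = 1 := by
    have := tm_coe 0
    simpa using this
  have h2 : tm.F 0 < tm.F t := (ext (OrderIso.addRight 1)).strictMono h
  rw [h1] at h2
  exact zero_lt_one.trans h2

theorem Fixes.mul {g h : W m ≃ₜ W m} (hg : Fixes g) (hh : Fixes h) : Fixes (g * h) := by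
  intro z hz
  change g (h z) = z
  rw [hh z hz, hg z hz]

theorem to_one_aux (n : ℕ) : ∀ w : List (Lt m), w.length = n → ∀ x : W m, Br w x → 0 < x.1 [] →
    ∃ g ∈ GG m, Fixes g ∧ g x = pp 1 := by
  induction n with
  | zero =>
    intro w hw x hx h0
    rw [List.length_eq_zero_iff] at hw
    subst hw
    have hx' := hx
    obtain ⟨d, h1, h2, h3⟩ := hx
    rw [h1] at h0
    obtain ⟨M, hM, hF, hM1⟩ := move (GG m) fm_mem um_mem d (by exact_mod_cast h0)
    refine ⟨M.A, hM, fixes_A hF, ?_⟩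
    obtain ⟨_, _, _, h3'⟩ := hx'.A_nil M
    have h4 : (M.A x).1 [] = 1 := by rw [M.A_nil, h1, hM1]
    have := eq_pp (x := M.A x) (by rw [h4]; exact EReal.coe_ne_bot 1) h3'
    rw [this, h4]
  | succ n ih =>
    intro w' hw' x hx h0
    obtain ⟨l, w, rfl⟩ := List.exists_cons_of_length_eq_add_one hw'
    have hw : w.length = n := by simpa using hw'
    have hxl : x.1 [] = vl l := by
      obtain ⟨d, h1, h2, h3⟩ := hx
      exact val_of_ext x (w := []) (v := w) h2.ne'
    rw [hxl] at h0
    obtain ⟨M, hM, hF, hM1⟩ := move (GG m) fm_mem um_mem l.1 (by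
      unfold vl at h0
      exact_mod_cast h0)
    have b1 := hx.A_cons M
    have b2 := b1.A_cons tm.symm
    have hσ : (M.σ l.1 : ℝ) = 1 := coe_one' _ (by rw [← M.spec]; exact hM1)
    have hl : ((tm.symm.σ (M.σ l.1), l.2) : Lt m) = zl l.2 := by
      refine Prod.ext (Subtype.ext ?_) rfl
      apply EReal.coe_injective
      rw [← tm.symm.spec]
      change tm.F.symm _ = _
      rw [Homeomorph.symm_apply_eq, hσ]
      change _ = tm.F ((0 : ℝ) : EReal)
      rw [tm_coe]
      simp
    simp only at b2
    rw [hl] at b2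
    obtain ⟨b3, b3'⟩ := b2.C
    set y := Waz.C l.2 (tm.symm.A (M.A x)) with hy
    have b4 : ∃ v : List (Lt m), v.length = n ∧ Br v (tm.A y) := by
      cases w with
      | nil => exact ⟨[], hw, b3.A_nil tm⟩
      | cons a w => exact ⟨_, by simpa using hw, b3.A_cons tm⟩
    obtain ⟨v, hv, b5⟩ := b4
    obtain ⟨g, hg, hgF, hg1⟩ := ih v hv _ b5 (tm_pos b3')
    refine ⟨g * (tm.A * Waz.C l.2 * tm.A⁻¹ * M.A), ?_, ?_, ?_⟩
    · exact mul_mem hg (mul_mem (mul_mem (mul_mem tm_mem (C_mem _)) (inv_mem tm_mem)) hM)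
    · exact hgF.mul ((fixes_D _).mul (fixes_A hF))
    · exact hg1

theorem to_one {x : W m} (hx : IsBr x) (h : 0 < x.1 []) : ∃ g ∈ GG m, Fixes g ∧ g x = pp 1 := by
  obtain ⟨w, hw⟩ := (isBr_iff x).1 hx
  exact to_one_aux _ w rfl x hw h

theorem rm_pos {t : EReal} (h : t < 0) : 0 < rm.F t := by
  change 0 < -t
  have := EReal.neg_lt_neg_iff.2 h
  rwa [neg_zero] at this

theorem rm_zero : rm.F 0 = 0 := neg_zero (G := EReal)

theorem exists_z {x : W m} (h : x.1 [] = 0) (hx : x ≠ pp 0) : ∃ i, x.1 [zl i] ≠ 0 := by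
  by_contra hc
  push Not at hc
  apply hx
  rw [← h]
  refine eq_pp (by rw [h]; exact EReal.zero_ne_bot) ?_
  intro l
  by_contra hl
  have h1 := x.2.val [] l hl
  rw [h] at h1
  have h2 : l = zl l.2 := by
    refine Prod.ext (Subtype.ext ?_) rfl
    apply EReal.coe_injective
    change vl l = _
    rw [← h1]
    rfl
  rw [h2] at hl
  exact hl (hc _)

theorem p0_br : IsBr (pp 0 : W m) :=
  ⟨[], ⟨0, Dy.zero⟩, by rw [pp_nil]; rfl, by rw [pp_nil]; exact EReal.bot_lt_zero,
    fun l => pp_letter _ _⟩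

theorem swaps (x : W m) (hx : x ≠ pp 0) : ∃ s ∈ GG m, s x ∈ TreeLike.comp (pp 0 : W m) (pp 1) ∧
    ∀ z, z ∉ TreeLike.comp (pp 0 : W m) x → z ∉ TreeLike.comp (pp 0 : W m) (pp 1) → s z = z := by
  rcases lt_trichotomy (x.1 []) 0 with h | h | h
  · refine ⟨rm.A, rm_mem, mem_pos.2 (rm_pos h), fun z h1 h2 => ?_⟩
    rw [mem_pos] at h2
    rw [TreeLike.comp, TreeLike.comp_dn (by rw [p0_le]; exact not_le_of_gt h)] at h1
    have h3 : 0 ≤ z.1 [] := by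
      by_contra hc
      exact h1 (fun h => hc (p0_le.1 h))
    have h4 : z.1 [] = 0 := le_antisymm (not_lt.1 h2) h3
    apply Mv.A_fix
    rw [h4, rm_zero]
  · obtain ⟨i, hi⟩ := exists_z h hx
    refine ⟨C i, C_mem i, mem_pos.2 (C_nil_pos hi), fun z h1 h2 => ?_⟩
    rw [mem_pos] at h2
    refine C_fix z (not_lt.1 h2) ?_
    by_contra hz
    have hx0 : pp 0 ≤ x := p0_le.2 h.ge
    have hz0 : pp 0 ≤ z := p0_le.2 (nil_of_z z hz).ge
    have hxi : 0 < x.1 [zl i] := lt_of_le_of_ne (x.2.nonneg _ (by simp)) (Ne.symm hi)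
    have hzi : 0 < z.1 [zl i] := lt_of_le_of_ne (z.2.nonneg _ (by simp)) (Ne.symm hz)
    rw [TreeLike.comp, TreeLike.comp_up (lt_of_le_of_ne hx0 (Ne.symm hx))] at h1
    apply h1
    change pp 0 < z ⊓ x
    refine (lt_iff_exists (le_inf hz0 hx0)).2 ⟨[zl i], ?_⟩
    rw [pp_letter, inf_apply]
    exact lt_inf_iff.2 ⟨hzi, hxi⟩
  · exact ⟨1, one_mem _, mem_pos.2 h, fun z _ _ => rfl⟩

theorem main (hm : 1 ≤ m) (φ : W m ≃ₜ W m) (F : Set (W m)) (hF : F.Finite)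
    (hFB : F ⊆ {x | IsBr x}) : ∃ g ∈ GG m, ∀ e ∈ F, g e = φ e := by
  have hinv : ∀ φ : W m ≃ₜ W m, ∀ b ∈ {x : W m | IsBr x}, φ b ∈ {x : W m | IsBr x} := by
    intro φ b hb
    have hb' : IsBr b := hb
    rw [← order_iff hm, ← ptOrder_homeo φ, order_iff hm] at hb'
    exact hb'
  have hpos : ∀ x : W m, IsBr x → ∃ g ∈ GG m, g x = pp 1 := by
    intro x hx
    have hx2 : ∃ s ∈ GG m, 0 < (s x).1 [] := by
      by_cases h : x = pp 0
      · refine ⟨tm.A, tm_mem, ?_⟩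
        rw [h, Mv.A_nil, pp_nil]
        have := tm_coe 0
        simp only [zero_add, EReal.coe_zero, EReal.coe_one] at this
        rw [this]
        exact zero_lt_one
      · obtain ⟨s, hs, h1, _⟩ := swaps x h
        exact ⟨s, hs, mem_pos.1 h1⟩
    obtain ⟨s, hs, h1⟩ := hx2
    obtain ⟨g, hg, _, h2⟩ := to_one (hinv s x hx) h1
    exact ⟨g * s, mul_mem hg hs, h2⟩
  refine TreeLike.density' infClosed_Br hinv ?_ p0_br (TreeLike.SR_of_swaps hinv ?_ swaps) φ F hF hFB
  · intro x hx y hy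
    obtain ⟨g, hg, h1⟩ := hpos x hx
    obtain ⟨h, hh, h2⟩ := hpos y hy
    refine ⟨h⁻¹ * g, mul_mem (inv_mem hh) hg, ?_⟩
    change h⁻¹ (g x) = y
    rw [h1, ← h2, TreeLike.inv_app]
  · intro x hx y hy hxp hyp
    obtain ⟨g, hg, hgF, h1⟩ := to_one hx (mem_pos.1 hxp)
    obtain ⟨h, hh, hhF, h2⟩ := to_one hy (mem_pos.1 hyp)
    refine ⟨h⁻¹ * g, mul_mem (inv_mem hh) hg, ?_, ?_⟩
    · change h⁻¹ (g x) = y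
      rw [h1, ← h2, TreeLike.inv_app]
    · intro z hz
      rw [mem_pos, not_lt] at hz
      change h⁻¹ (g z) = z
      rw [hgF z hz, TreeLike.inv_fix (hhF z hz)]

end Waz

theorem statement8 (n : ℕ) (hn : 3 ≤ n) :
    ∃ (X : Type) (_ : TopologicalSpace X) (_ : IsWazewskiDendrite n X)
      (G : Subgroup (X ≃ₜ X)),
      G.FG ∧
      ∀ φ : X ≃ₜ X, ∀ k : ℕ, 1 ≤ k → ∀ p : Fin k → X,
        (∀ i, ptOrder X (p i) = n) →
        ∃ g ∈ G, ∀ i, (g : X ≃ₜ X) (p i) = φ (p i) := by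
  obtain ⟨m, hm, rfl⟩ : ∃ m, 1 ≤ m ∧ n = m + 2 := ⟨n - 2, by omega, by omega⟩
  refine ⟨Waz.W m, inferInstance, Waz.isWaz m, Waz.GG m, Waz.GG_fg m, ?_⟩
  intro φ k _ p hp
  obtain ⟨g, hg, h⟩ := Waz.main hm φ (Set.range p) (Set.finite_range p) (by
    rintro _ ⟨i, rfl⟩
    exact (Waz.order_iff hm _).1 (hp i))
  exact ⟨g, hg, fun i => h _ ⟨i, rfl⟩⟩
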